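/- Let d ≥ 4, let (ρ_n)_{n∈ℕ} be an appropriate family, and let ε ∈ (0,1). Then for all sufficiently large n, the cluster of the origin in ℐ^{(1−ε)u_n, ρ_n} is almost surely finite; in particular u_*(ρ_n) ≥ (1−ε)·u_n. -/

import Mathlib

open MeasureTheory ProbabilityTheory Filter Topology
open scoped ENNReal NNReal Classical

noncomputable section

namespace FRIPaper

/-- The lattice `ℤ^d`. -/
abbrev Zd (d : ℕ) := Fin d → ℤ

/-- `x` and `y` are nearest neighbours in `ℤ^d` (`ℓ¹`-distance one). -/
def IsNN {d : ℕ} (x y : Zd d) : Prop := (∑ i, (x i - y i).natAbs) = 1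

/-- Event that a one-sided path never visits `A` at a positive time
(i.e. `H̃_A = ∞` for the path started anywhere). -/
def NoReturn {d : ℕ} (A : Set (Zd d)) : Set (ℕ → Zd d) := {ω | ∀ t : ℕ, 0 < t → ω t ∉ A}

/-- Event that a one-sided path does not visit `A` at a positive time `t ≤ s`
(i.e. `H̃_A > s`). -/
def NoReturnUpTo {d : ℕ} (A : Set (Zd d)) (s : ℝ) : Set (ℕ → Zd d) :=
  {ω | ∀ t : ℕ, 0 < t → (t : ℝ) ≤ s → ω t ∉ A}

/-- Specification of the law `P^x` of the discrete-time simple random walk on `ℤ^d`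
started at `x`, as a measure on the path space `ℕ → ℤ^d`: it is the unique probability
measure giving each nearest-neighbour cylinder of length `T` based at `x`
probability `(2d)^{-T}`. -/
def IsSRW (d : ℕ) (x : Zd d) (P : Measure (ℕ → Zd d)) : Prop :=
  IsProbabilityMeasure P ∧
    ∀ (T : ℕ) (w : ℕ → Zd d),
      P {ω | ∀ t ≤ T, ω t = w t} =
        if w 0 = x ∧ ∀ t < T, IsNN (w t) (w (t + 1)) then
          (((2 * d : ℕ) : ℝ≥0∞))⁻¹ ^ T else 0

/-- A family `P x`, `x ∈ ℤ^d`, of simple random walk laws. -/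
def IsSRWFamily (d : ℕ) (P : Zd d → Measure (ℕ → Zd d)) : Prop := ∀ x, IsSRW d x (P x)

/-- Equilibrium measure `e_A(x) = P^x[H̃_A = ∞] 1_{x ∈ A}`. -/
def equil {d : ℕ} (P : Zd d → Measure (ℕ → Zd d)) (A : Set (Zd d)) (x : Zd d) : ℝ :=
  if x ∈ A then (P x (NoReturn A)).toReal else 0

/-- Capacity `cap(A) = Σ_{x∈A} e_A(x)`. -/
def capacity {d : ℕ} (P : Zd d → Measure (ℕ → Zd d)) (A : Finset (Zd d)) : ℝ :=
  ∑ x ∈ A, equil P (↑A) x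

/-- Truncated capacity `cap(A,T) = Σ_{x∈A} P^x[H̃_A > T·(log T)^{-10}]`. -/
def capTrunc {d : ℕ} (P : Zd d → Measure (ℕ → Zd d)) (A : Finset (Zd d)) (T : ℝ) : ℝ :=
  ∑ x ∈ A, (P x (NoReturnUpTo (↑A) (T / (Real.log T) ^ (10 : ℕ)))).toReal

/-- `X[a,b]`, the set of points visited by the path between times `a` and `b`. -/
def walkRange {d : ℕ} (ω : ℕ → Zd d) (a b : ℕ) : Finset (Zd d) := (Finset.Icc a b).image ω

/-- `E^0[cap(X[0,T])]`. -/
def capExpect {d : ℕ} (P : Zd d → Measure (ℕ → Zd d)) (T : ℕ) : ℝ :=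
  ∫ ω, capacity P (walkRange ω 0 T) ∂ (P 0)

/-- `1 + log x · 1_{d = 4}`. -/
def logFour (d : ℕ) (x : ℝ) : ℝ := 1 + if d = 4 then Real.log x else 0

/-- `ε` is the constant `ε_d = lim_{T→∞} E^0[cap(X[0,T])]·T^{-1}·(1 + log T·1_{d=4})`,
which lies in `(0,∞)`. -/
def IsCapLimit (d : ℕ) (P : Zd d → Measure (ℕ → Zd d)) (ε : ℝ) : Prop :=
  0 < ε ∧ Tendsto (fun T : ℕ => capExpect P T * logFour d T / (T : ℝ)) atTop (𝓝 ε)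

/-! ### Distributions on `ℕ` -/

/-- `ρ` is a probability distribution on `ℕ`. -/
def IsDist (ρ : ℕ → ℝ) : Prop := (∀ k, 0 ≤ ρ k) ∧ HasSum ρ 1

/-- `k`-th moment `μ_k(ρ)`. -/
def mu (k : ℕ) (ρ : ℕ → ℝ) : ℝ := ∑' l : ℕ, (l : ℝ) ^ k * ρ l

/-- Tail `μ_k^{(m)}(ρ) = Σ_{l ≥ m} l^k ρ(l)`. -/
def muTail (k m : ℕ) (ρ : ℕ → ℝ) : ℝ := ∑' l : ℕ, if m ≤ l then (l : ℝ) ^ k * ρ l else 0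

/-- An appropriate family of distributions on `ℕ`. -/
def Appropriate (ρ : ℕ → ℕ → ℝ) : Prop :=
  (∀ n, IsDist (ρ n)) ∧
  (∀ n, Summable fun l : ℕ => (l : ℝ) ^ 2 * ρ n l) ∧
  Tendsto (fun n => mu 1 (ρ n)) atTop atTop ∧
  ∀ ε : ℝ, 0 < ε → ∃ C : ℝ,
    ∀ n, (∑' L : ℕ, if C * mu 1 (ρ n) ≤ (L : ℝ) then (L : ℝ) ^ 2 * ρ n L / mu 2 (ρ n) else 0) ≤ ε

/-- Geometric distribution `Geo(λ)(k) = λ (1-λ)^k`. -/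
def geo (lam : ℝ) (k : ℕ) : ℝ := lam * (1 - lam) ^ k

/-! ### Trajectories and finitary random interlacements -/

/-- A finite trajectory in `ℤ^d`, recorded as the list of its positions. -/
abbrev Traj (d : ℕ) := List (Zd d)

/-- A point configuration: the multiplicity of each trajectory. -/
abbrev Config (d : ℕ) := Traj d → ℕ

/-- A valid trajectory: a nonempty nearest-neighbour path. -/
def ValidTraj {d : ℕ} (η : Traj d) : Prop := η ≠ [] ∧ η.Chain' IsNN

/-- The time length `T(η)` of a trajectory. -/
def len {d : ℕ} (η : Traj d) : ℕ := η.length - 1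

/-- The range of a trajectory, as a set. -/
def rangeSet {d : ℕ} (η : Traj d) : Set (Zd d) := {y | y ∈ η}

/-- The trajectory `η` visits the set `A`. -/
def hits {d : ℕ} (η : Traj d) (A : Set (Zd d)) : Prop := ∃ y ∈ η, y ∈ A

/-- Poisson probability mass `e^{-r} r^n / n!`. -/
def poissonProb (r : ℝ) (n : ℕ) : ℝ≥0∞ :=
  ENNReal.ofReal (Real.exp (-r) * r ^ n / n.factorial)

/-- The intensity `u·π({η})` that FRI with parameters `(u,ρ)` puts on a single
trajectory `η`: trajectories of length `l` from each starting point carry mass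
`u·ρ(l)/(μ₁(ρ)+1)·(2d)^{-l}` each. -/
def friIntensity (d : ℕ) (u : ℝ) (ρ : ℕ → ℝ) (η : Traj d) : ℝ :=
  if ValidTraj η then u * ρ (len η) / (mu 1 ρ + 1) * (1 / (2 * (d : ℝ))) ^ (len η) else 0

/-- `P` is the law of a Poisson point process on the countable set of trajectories
with intensity function `ι`: the multiplicities of distinct trajectories are
independent Poisson random variables. -/
def IsPoissonPP (d : ℕ) (ι : Traj d → ℝ) (P : Measure (Config d)) : Prop :=
  IsProbabilityMeasure P ∧
    ∀ (F : Finset (Traj d)) (k : Traj d → ℕ),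
      P {ω | ∀ η ∈ F, ω η = k η} = ∏ η ∈ F, poissonProb (ι η) (k η)

/-- `P` is the law of the finitary random interlacements point process `𝒳^{u,ρ}`. -/
def IsFRI (d : ℕ) (u : ℝ) (ρ : ℕ → ℝ) (P : Measure (Config d)) : Prop :=
  IsPoissonPP d (friIntensity d u ρ) P

/-- `J` is the law of an i.i.d. sequence of copies of `𝒳^{u,ρ}`. -/
def IsFRIseq (d : ℕ) (u : ℝ) (ρ : ℕ → ℝ) (J : Measure (ℕ → Config d)) : Prop :=
  IsProbabilityMeasure J ∧
    ∀ (F : Finset (ℕ × Traj d)) (k : ℕ × Traj d → ℕ),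
      J {j | ∀ p ∈ F, j p.1 p.2 = k p} = ∏ p ∈ F, poissonProb (friIntensity d u ρ p.2) (k p)

/-! ### Percolation -/

/-- The edge `{x,y}` is traversed by some trajectory of the configuration `ω`. -/
def EdgeOpen {d : ℕ} (ω : Config d) (x y : Zd d) : Prop :=
  ∃ η : Traj d, 0 < ω η ∧ ∃ i : ℕ,
    (η[i]? = some x ∧ η[i + 1]? = some y) ∨ (η[i]? = some y ∧ η[i + 1]? = some x)

/-- The cluster of `x` in the subgraph `ℐ` induced by the configuration `ω`. -/
def Cluster {d : ℕ} (ω : Config d) (x : Zd d) : Set (Zd d) :=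
  {y | Relation.ReflTransGen (EdgeOpen ω) x y}

/-- The origin lies in an infinite cluster. -/
def PercEvent (d : ℕ) : Set (Config d) := {ω | (Cluster ω 0).Infinite}

/-- The critical intensity `u_*(ρ)`, given the family `u ↦ 𝒳^{u,ρ}`. -/
def uStar (d : ℕ) (X : ℝ → Measure (Config d)) : ℝ :=
  sInf {u : ℝ | 0 ≤ u ∧ 0 < X u (PercEvent d)}

/-- The order `u_n = μ₁(ρ)·(1 + log μ₁(ρ)·1_{d=4}) / (ε_d·μ₂(ρ))` of the
critical intensity. -/
def uN (d : ℕ) (εd : ℝ) (ρ : ℕ → ℝ) : ℝ :=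
  mu 1 ρ * logFour d (mu 1 ρ) / (εd * mu 2 ρ)

/-! ### `ρ`-capacity, Green function, `κ` and `φ` -/

/-- `e_A^{(ρ)}(x) = Σ_m (μ₀^{(m)}(ρ)/(μ₁(ρ)+1))·P^x[H̃_A > m]`. -/
def equilRho {d : ℕ} (P : Zd d → Measure (ℕ → Zd d)) (ρ : ℕ → ℝ) (A : Set (Zd d))
    (x : Zd d) : ℝ :=
  ∑' m : ℕ, (muTail 0 m ρ / (mu 1 ρ + 1)) * (P x (NoReturnUpTo A (m : ℝ))).toReal

/-- `cap^{(ρ)}(A) = Σ_{x∈A} e_A^{(ρ)}(x)`. -/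
def capRho {d : ℕ} (P : Zd d → Measure (ℕ → Zd d)) (ρ : ℕ → ℝ) (A : Finset (Zd d)) : ℝ :=
  ∑ x ∈ A, equilRho P ρ (↑A) x

/-- Green's function `g(x,y) = Σ_t P^x[X_t = y]`. -/
def green {d : ℕ} (P : Zd d → Measure (ℕ → Zd d)) (x y : Zd d) : ℝ :=
  ∑' t : ℕ, (P x {ω | ω t = y}).toReal

/-- `φ^{(ρ)}(A,B) = Σ_{x∈A} Σ_{y∈B} e_A^{(ρ)}(x) e_B^{(ρ)}(y) g(x,y)`. -/
def phiRho {d : ℕ} (P : Zd d → Measure (ℕ → Zd d)) (ρ : ℕ → ℝ) (A B : Finset (Zd d)) : ℝ :=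
  ∑ x ∈ A, ∑ y ∈ B, equilRho P ρ (↑A) x * equilRho P ρ (↑B) y * green P x y

/-- `κ^{(ρ)}(A) = Σ_{x∈A} Σ_m (μ₁^{(m)}(ρ)/μ₂(ρ))·P^x[H̃_A > m]` (real-valued,
for finite `A`). -/
def kappa {d : ℕ} (P : Zd d → Measure (ℕ → Zd d)) (ρ : ℕ → ℝ) (A : Finset (Zd d)) : ℝ :=
  ∑ x ∈ A, ∑' m : ℕ, (muTail 1 m ρ / mu 2 ρ) * (P x (NoReturnUpTo (↑A) (m : ℝ))).toReal

/-- `κ^{(ρ)}(A)` as an extended-real valued quantity, for arbitrary `A`. -/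
def kappaE {d : ℕ} (P : Zd d → Measure (ℕ → Zd d)) (ρ : ℕ → ℝ) (A : Set (Zd d)) : ℝ≥0∞ :=
  ∑' x : Zd d,
    A.indicator (fun x => ∑' m : ℕ,
      ENNReal.ofReal (muTail 1 m ρ / mu 2 ρ) * P x (NoReturnUpTo A (m : ℝ))) x

/-! ### Exploration processes -/

/-- First components: the `k`-th layer `L_k` of vertices; second components:
`∪_{i<k} L_i`.  Layer `L_{k+1}` is spanned by the trajectories of `ω` meeting `L_k`
but not `∪_{i<k} L_i`. -/
def exploreSets {d : ℕ} (ω : Config d) : ℕ → Set (Zd d) × Set (Zd d)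
  | 0 => ({0}, ∅)
  | k + 1 =>
    ({y | ∃ η : Traj d, 0 < ω η ∧ hits η (exploreSets ω k).1 ∧
        ¬ hits η (exploreSets ω k).2 ∧ y ∈ η},
      (exploreSets ω k).1 ∪ (exploreSets ω k).2)

/-- The `i`-th layer `𝓛_i` of trajectories of the exploration of the cluster of the
origin, as a sub-configuration of `ω`. -/
def exploreLayer {d : ℕ} (ω : Config d) : ℕ → Config d
  | 0 => fun _ => 0
  | k + 1 => fun η =>
      if hits η (exploreSets ω k).1 ∧ ¬ hits η (exploreSets ω k).2 then ω η else 0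

/-- The vertex sets `L'_k` of the dominating exploration driven by the i.i.d.
sequence `j`. -/
def exploreSets' {d : ℕ} (j : ℕ → Config d) : ℕ → Set (Zd d)
  | 0 => {0}
  | k + 1 => {y | ∃ η : Traj d, 0 < j (k + 1) η ∧ hits η (exploreSets' j k) ∧ y ∈ η}

/-- The trajectory layers `𝓛'_i` of the dominating exploration. -/
def exploreLayer' {d : ℕ} (j : ℕ → Config d) : ℕ → Config d
  | 0 => fun _ => 0
  | k + 1 => fun η => if hits η (exploreSets' j k) then j (k + 1) η else 0

/-- `W_k = 𝔼[κ^{(ρ)}(L'_k)]`. -/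
def Wexp {d : ℕ} (P : Zd d → Measure (ℕ → Zd d)) (ρ : ℕ → ℝ)
    (J : Measure (ℕ → Config d)) (k : ℕ) : ℝ≥0∞ :=
  ∫⁻ j, kappaE P ρ (exploreSets' j k) ∂ J

/-- `V_k = 𝔼[|L'_k|]`, multiplied by `(log μ₁(ρ))⁻¹` when `d = 4`. -/
def Vexp (d : ℕ) (ρ : ℕ → ℝ) (J : Measure (ℕ → Config d)) (k : ℕ) : ℝ≥0∞ :=
  (if d = 4 then ENNReal.ofReal (1 / Real.log (mu 1 ρ)) else 1) *
    ∫⁻ j, ENat.toENNReal (exploreSets' j k).encard ∂ J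

/-! ### Two-sided finite random walk trajectories -/

/-- `μ(x,m,l)({η})`: the two-sided path `(X_{-m},…,X_l)` of a doubly infinite walk
with `X_0 = x` equals the list `η` (of length `m+l+1`, with `η[m] = x`)
with probability `(2d)^{-(m+l)}` for every admissible nearest-neighbour list. -/
def twoSidedProb (d : ℕ) (x : Zd d) (m l : ℕ) (η : Traj d) : ℝ :=
  if η.length = m + l + 1 ∧ η.Chain' IsNN ∧ η[m]? = some x then
    (1 / (2 * (d : ℝ))) ^ (m + l) else 0

/-- The `ℓ^∞`-diameter of the range of `η` is at most `R`. -/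
def DiamLE {d : ℕ} (η : Traj d) (R : ℝ) : Prop :=
  ∀ a ∈ η, ∀ b ∈ η, ∀ i, |((a i - b i : ℤ) : ℝ)| ≤ R

/-- `P^x[X[-m,-1] ∩ A = ∅]`: the probability that an `m`-step walk from `x`
avoids `A` at all positive times, written combinatorially. -/
def backAvoidProb (d : ℕ) (A : Set (Zd d)) (x : Zd d) (m : ℕ) : ℝ :=
  ∑' w : Traj d,
    if w.length = m + 1 ∧ w.Chain' IsNN ∧ w[0]? = some x ∧
        (∀ i : ℕ, 0 < i → ∀ y, w[i]? = some y → y ∉ A) then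
      (1 / (2 * (d : ℝ))) ^ m else 0

/-- `μ(x,m,l;A)({η}) = P^x[X[-m,l] = η | X[-m,-1] ∩ A = ∅]`. -/
def condTwoSidedProb (d : ℕ) (A : Set (Zd d)) (x : Zd d) (m l : ℕ) (η : Traj d) : ℝ :=
  (if ∀ i < m, ∀ y, η[i]? = some y → y ∉ A then twoSidedProb d x m l η else 0) /
    backAvoidProb d A x m

/-- `π_A({η}) = Σ_{x∈A} Σ_{m,l} (ρ(m+l)/(μ₁(ρ)+1))·P^x[H̃_A > m]·μ(x,m,l;A)({η})`. -/
def piA (d : ℕ) (P : Zd d → Measure (ℕ → Zd d)) (ρ : ℕ → ℝ) (A : Finset (Zd d))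
    (η : Traj d) : ℝ :=
  ∑ x ∈ A, ∑' m : ℕ, ∑' l : ℕ,
    ρ (m + l) / (mu 1 ρ + 1) * (P x (NoReturnUpTo (↑A) (m : ℝ))).toReal *
      condTwoSidedProb d (↑A) x m l η

/-- The sub-configuration of trajectories meeting `A`, i.e. `𝒳[A]`. -/
def restrictConfig {d : ℕ} (A : Finset (Zd d)) (ω : Config d) : Config d :=
  fun η => if hits η (↑A) then ω η else 0

/-! ### Products and geometric laws -/

/-- The geometric measure `Geo(1/(T+1))` on `ℕ`. -/
def geoMeasure (T : ℕ) : Measure ℕ :=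
  Measure.sum fun k : ℕ => (ENNReal.ofReal (geo (1 / ((T : ℝ) + 1)) k)) • Measure.dirac k

/-- `Q` is the product (independent coupling) of `μ` and `ν`. -/
def IsProdOf {α β : Type*} [MeasurableSpace α] [MeasurableSpace β]
    (Q : Measure (α × β)) (μ : Measure α) (ν : Measure β) : Prop :=
  IsProbabilityMeasure Q ∧
    ∀ (A : Set α) (B : Set β), MeasurableSet A → MeasurableSet B → Q (A ×ˢ B) = μ A * ν B

/-! ### Coarse graining quantities -/

/-- The constant `c = 0.01`. -/
def cConst : ℝ := 0.01

/-- `R_n = ⌊√(μ₁(ρ_n))⌋`. -/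
def Rn (ρ : ℕ → ℕ → ℝ) (n : ℕ) : ℕ := ⌊Real.sqrt (mu 1 (ρ n))⌋₊

/-- The mesoscopic scale `L_n`. -/
def Ln (d : ℕ) (ρ : ℕ → ℕ → ℝ) (n : ℕ) : ℝ :=
  if d = 4 then (Rn ρ n : ℝ) * (Real.log (Rn ρ n)) ^ (-cConst)
  else (Rn ρ n : ℝ) ^ ((2 + cConst) / ((d : ℝ) - 2))

/-- The slowly growing factor `I_n`. -/
def In (d : ℕ) (ρ : ℕ → ℕ → ℝ) (n : ℕ) : ℝ :=
  if d = 4 then (Real.log (Rn ρ n)) ^ cConst else (Rn ρ n : ℝ) ^ cConst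

/-- The scale `T'_n`. -/
def Tn' (d : ℕ) (ρ : ℕ → ℕ → ℝ) (n : ℕ) : ℕ :=
  if d = 4 then ⌊(Rn ρ n : ℝ) ^ (2 : ℕ) / Real.log (mu 1 (ρ n))⌋₊
  else ⌊(Rn ρ n : ℝ) ^ ((2 : ℝ) - cConst / 4)⌋₊

/-- The scale `l_n`. -/
def lnPar (d : ℕ) (ρ : ℕ → ℕ → ℝ) (n : ℕ) : ℕ :=
  if d = 4 then ⌊(Rn ρ n : ℝ) * (Real.log (Rn ρ n)) ^ (-(2 * cConst))⌋₊
  else ⌊(Rn ρ n : ℝ) ^ ((1 : ℝ) - cConst / 4)⌋₊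

/-- The scale `t_n`. -/
def tnPar (d : ℕ) (ρ : ℕ → ℕ → ℝ) (n : ℕ) : ℕ :=
  if d = 4 then ⌊(Rn ρ n : ℝ) ^ (2 : ℕ) / (Real.log (Rn ρ n)) ^ (10 : ℕ)⌋₊
  else ⌊(Rn ρ n : ℝ) ^ ((2 : ℝ) - cConst)⌋₊

/-- `y` is within `ℓ^∞`-distance `r` of `z`. -/
def InBall {d : ℕ} (y z : Zd d) (r : ℝ) : Prop := ∀ i, |((y i - z i : ℤ) : ℝ)| ≤ r

/-- The `ℓ^∞` `r`-neighbourhood `B(A,r)`. -/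
def nbhd {d : ℕ} (A : Set (Zd d)) (r : ℝ) : Set (Zd d) := {y | ∃ z ∈ A, InBall y z r}

/-- The sub-path `η[a, b]` of a trajectory. -/
def segment {d : ℕ} (η : Traj d) (a b : ℕ) : Traj d := (η.drop a).take (b - a + 1)

/-- `η` is a typical trajectory (the event `𝒯_n = ℰ₁ ∩ ℰ₂ ∩ ℰ₃ ∩ ℰ₄`). -/
def Typical (d : ℕ) (P : Zd d → Measure (ℕ → Zd d)) (εd : ℝ) (ρ : ℕ → ℕ → ℝ)
    (kk KK M θ1 : ℝ) (n : ℕ) (η : Traj d) : Prop :=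
  ValidTraj η ∧
  -- ℰ₁
  (kk * (Rn ρ n : ℝ) ^ 2 ≤ (len η : ℝ) ∧ (len η : ℝ) ≤ KK * (Rn ρ n : ℝ) ^ 2 ∧
    ∀ y ∈ η, InBall y η.headI (M * (Rn ρ n : ℝ))) ∧
  -- ℰ₂
  (if d = 4 then
    (1 - θ1 ^ 2) * (Real.pi ^ 2 / 8) * (len η : ℝ) / Real.log (mu 1 (ρ n)) <
        capacity P η.toFinset ∧
      capTrunc P η.toFinset ((Rn ρ n : ℝ) ^ 2) <
        (1 + θ1 ^ 2) * (Real.pi ^ 2 / 8) * (len η : ℝ) / Real.log (mu 1 (ρ n))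
  else
    (1 - θ1 ^ 2) * εd * (len η : ℝ) < capacity P η.toFinset ∧
      capacity P η.toFinset < (1 + θ1 ^ 2) * εd * (len η : ℝ)) ∧
  -- ℰ₃
  ((Set.ncard (nbhd (rangeSet η) (Ln d ρ n)) : ℝ) <
    (Rn ρ n : ℝ) ^ 2 * (Ln d ρ n) ^ (d - 2) * (In d ρ n) ^ ((1 : ℝ) / 3)) ∧
  -- ℰ₄
  (∀ j : ℕ, j * Tn' d ρ n ≤ len η →
    if d = 4 then
      capacity P (segment η (j * Tn' d ρ n) (min ((j + 1) * Tn' d ρ n) (len η))).toFinset ≤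
          (1 + θ1 ^ 2) * (Real.pi ^ 2 / 8) * (Tn' d ρ n : ℝ) / Real.log (mu 1 (ρ n)) ∧
        ∀ a ∈ segment η (j * Tn' d ρ n) (min ((j + 1) * Tn' d ρ n) (len η)),
          ∀ b ∈ segment η (j * Tn' d ρ n) (min ((j + 1) * Tn' d ρ n) (len η)),
            ∀ i, |((a i - b i : ℤ) : ℝ)| <
              (1 / 2) * Real.sqrt (len η : ℝ) * (Real.log (mu 1 (ρ n))) ^ (-cConst)
    else
      capacity P (segment η (j * Tn' d ρ n) (min ((j + 1) * Tn' d ρ n) (len η))).toFinset ≤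
        (1 + θ1 ^ 2) * εd * (Tn' d ρ n : ℝ))

/-- `x` belongs to the `*`-proper part `η̂` of the trajectory `η`. -/
def ProperStar (d : ℕ) (P : Zd d → Measure (ℕ → Zd d)) (ρ : ℕ → ℕ → ℝ)
    (θ1 θ2 : ℝ) (n : ℕ) (η : Traj d) (x : Zd d) : Prop :=
  x ∈ rangeSet η ∧
    (if d = 4 then
      θ2 / Real.log (mu 1 (ρ n)) ≤ equil P (rangeSet η) x ∧
        (P x (NoReturnUpTo (rangeSet η)
            ((Rn ρ n : ℝ) ^ 2 / (Real.log (Rn ρ n)) ^ (10 : ℕ)))).toReal ≤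
          (1 + θ1) * equil P (rangeSet η) x
    else θ2 ≤ equil P (rangeSet η) x)


/-! ### Part A: finite walk expectations -/

/-- One-step transition weight. -/
def kk {d : ℕ} (x y : Zd d) : ℝ≥0∞ := if IsNN x y then ((2 * d : ℕ) : ℝ≥0∞)⁻¹ else 0

/-- Expectation over `l`-step walks from `x` of a function of the list of later positions. -/
def EL {d : ℕ} : ℕ → Zd d → (List (Zd d) → ℝ≥0∞) → ℝ≥0∞
  | 0, _, F => F []
  | l + 1, x, F => ∑' y, kk x y * EL l y (fun b => F (y :: b))

/-- Last point. -/
def lst {d : ℕ} : Zd d → List (Zd d) → Zd d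
  | x, [] => x
  | _, y :: b => lst y b

/-- Weight of a path. -/
def wt {d : ℕ} : Zd d → List (Zd d) → ℝ≥0∞
  | _, [] => 1
  | x, y :: b => kk x y * wt y b

lemma EL_mono {d : ℕ} (l : ℕ) (x : Zd d) {F G : List (Zd d) → ℝ≥0∞}
    (h : ∀ b, b.length = l → F b ≤ G b) : EL l x F ≤ EL l x G := by
  induction l generalizing x F G with
  | zero => exact h [] rfl
  | succ l ih =>
    refine ENNReal.tsum_le_tsum fun y => ?_
    gcongr
    exact ih y fun b hb => h _ (by simp [hb])

lemma EL_congr {d : ℕ} (l : ℕ) (x : Zd d) {F G : List (Zd d) → ℝ≥0∞}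
    (h : ∀ b, b.length = l → F b = G b) : EL l x F = EL l x G :=
  le_antisymm (EL_mono l x fun b hb => (h b hb).le) (EL_mono l x fun b hb => (h b hb).ge)

lemma EL_add {d : ℕ} (l : ℕ) (x : Zd d) (F G : List (Zd d) → ℝ≥0∞) :
    EL l x (fun b => F b + G b) = EL l x F + EL l x G := by
  induction l generalizing x F G with
  | zero => rfl
  | succ l ih =>
    simp only [EL]
    rw [← ENNReal.tsum_add]
    refine tsum_congr fun y => ?_
    rw [ih, mul_add]

lemma EL_mul {d : ℕ} (l : ℕ) (x : Zd d) (c : ℝ≥0∞) (F : List (Zd d) → ℝ≥0∞) :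
    EL l x (fun b => c * F b) = c * EL l x F := by
  induction l generalizing x F with
  | zero => rfl
  | succ l ih =>
    simp only [EL]
    rw [← ENNReal.tsum_mul_left]
    refine tsum_congr fun y => ?_
    rw [ih]; ring

lemma EL_tsum {d : ℕ} {ι : Type*} (l : ℕ) (x : Zd d) (F : ι → List (Zd d) → ℝ≥0∞) :
    EL l x (fun b => ∑' i, F i b) = ∑' i, EL l x (F i) := by
  induction l generalizing x F with
  | zero => rfl
  | succ l ih =>
    simp only [EL]
    rw [ENNReal.tsum_comm]
    refine tsum_congr fun y => ?_
    rw [ih, ENNReal.tsum_mul_left]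

lemma EL_append {d : ℕ} (k l : ℕ) (x : Zd d) (F : List (Zd d) → ℝ≥0∞) :
    EL (k + l) x F = EL k x (fun b => EL l (lst x b) (fun c => F (b ++ c))) := by
  induction k generalizing x F with
  | zero => simp [EL, lst]
  | succ k ih =>
    rw [Nat.succ_add]
    simp only [EL]
    refine tsum_congr fun y => ?_
    rw [ih]; rfl

/-- unit steps -/
def stepv {d : ℕ} (p : Fin d × Bool) : Zd d := Pi.single p.1 (if p.2 then 1 else -1)

lemma stepv_inj {d : ℕ} : Function.Injective (stepv (d := d)) := by
  rintro ⟨i, b⟩ ⟨j, c⟩ h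
  have h1 := congrFun h i
  by_cases hij : i = j
  · subst hij
    simp only [stepv, Pi.single_eq_same] at h1
    cases b <;> cases c <;> simp_all
  · simp only [stepv, Pi.single_eq_same, Pi.single_eq_of_ne hij] at h1
    cases b <;> simp_all

lemma isNN_iff {d : ℕ} (x y : Zd d) : IsNN x y ↔ ∃ p, y = x + stepv p := by
  constructor
  · intro h
    unfold IsNN at h
    have hex : ∃ i, (x i - y i).natAbs ≠ 0 := by
      by_contra hcon
      push Not at hcon
      simp [hcon] at h
    obtain ⟨i, hi⟩ := hex
    have hs := Finset.add_sum_erase Finset.univ (fun i => (x i - y i).natAbs) (Finset.mem_univ i)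
    have h1 : (x i - y i).natAbs = 1 := by omega
    have h0 : ∑ j ∈ Finset.univ.erase i, (x j - y j).natAbs = 0 := by omega
    rw [Finset.sum_eq_zero_iff] at h0
    refine ⟨(i, decide (x i - y i = -1)), ?_⟩
    funext j
    by_cases hj : j = i
    · subst hj
      simp only [stepv, Pi.add_apply, Pi.single_eq_same]
      rcases Int.natAbs_eq (x j - y j) with h2 | h2 <;> rw [h1] at h2
      · simp [h2]; omega
      · simp [h2]; push_cast at h2; omega
    · have := h0 j (by simp [hj])
      simp only [stepv, Pi.add_apply, Pi.single_eq_of_ne hj]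
      omega
  · rintro ⟨⟨i, b⟩, rfl⟩
    unfold IsNN
    rw [Finset.sum_eq_single i]
    · cases b <;> simp [stepv]
    · intro j _ hj; simp [stepv, Pi.single_eq_of_ne hj]
    · simp

lemma isNN_symm {d : ℕ} {x y : Zd d} (h : IsNN x y) : IsNN y x := by
  unfold IsNN at *
  rw [← h]
  exact Finset.sum_congr rfl fun i _ => by omega

lemma kk_tsum {d : ℕ} (x : Zd d) (g : Zd d → ℝ≥0∞) :
    ∑' y, kk x y * g y = ∑ p : Fin d × Bool, ((2 * d : ℕ) : ℝ≥0∞)⁻¹ * g (x + stepv p) := by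
  have hinj : Function.Injective (fun p : Fin d × Bool => x + stepv p) :=
    fun a b h => stepv_inj (add_left_cancel h)
  rw [← Function.Injective.tsum_eq hinj, tsum_fintype]
  · refine Finset.sum_congr rfl fun p _ => ?_
    have : IsNN x (x + stepv p) := (isNN_iff _ _).2 ⟨p, rfl⟩
    simp [kk, this]
  · intro y hy
    have : IsNN x y := by
      by_contra h
      simp [kk, h] at hy
    obtain ⟨p, rfl⟩ := (isNN_iff _ _).1 this
    exact ⟨p, rfl⟩

lemma kk_sum {d : ℕ} (hd : 0 < d) (x : Zd d) : ∑' y, kk x y = 1 := by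
  have := kk_tsum x (fun _ => 1)
  simp only [mul_one] at this
  rw [this]
  simp only [Finset.sum_const, Finset.card_univ, Fintype.card_prod, Fintype.card_fin,
    Fintype.card_bool, nsmul_eq_mul]
  rw [mul_comm d 2]
  exact ENNReal.mul_inv_cancel (by simp; omega) (by simp [ENNReal.mul_eq_top])

lemma EL_one {d : ℕ} (hd : 0 < d) (l : ℕ) (x : Zd d) : EL l x (fun _ => 1) = 1 := by
  induction l generalizing x with
  | zero => rfl
  | succ l ih => simp [EL, ih, kk_sum hd]

lemma EL_const {d : ℕ} (hd : 0 < d) (l : ℕ) (x : Zd d) (c : ℝ≥0∞) : EL l x (fun _ => c) = c := by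
  have := EL_mul l x c (fun _ => 1)
  simpa [EL_one hd] using this

lemma kk_add {d : ℕ} (x y z : Zd d) : kk (x + z) (y + z) = kk x y := by
  simp [kk, IsNN]

lemma EL_translate {d : ℕ} (l : ℕ) (x z : Zd d) (F : List (Zd d) → ℝ≥0∞) :
    EL l (x + z) F = EL l x (fun b => F (b.map (· + z))) := by
  induction l generalizing x F with
  | zero => rfl
  | succ l ih =>
    simp only [EL]
    rw [← (Equiv.addRight z).tsum_eq]
    refine tsum_congr fun y => ?_
    simp only [Equiv.coe_addRight, kk_add, ih, List.map_cons]

lemma tsum_list {α : Type*} (H : List α → ℝ≥0∞) :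
    ∑' b, H b = H [] + ∑' y, ∑' b, H (y :: b) := by
  let e : Option (α × List α) ≃ List α :=
    { toFun := fun o => match o with
        | none => []
        | some p => p.1 :: p.2
      invFun := fun l => match l with
        | [] => none
        | y :: b => some (y, b)
      left_inv := by rintro (_ | ⟨y, b⟩) <;> rfl
      right_inv := by rintro (_ | ⟨y, b⟩) <;> rfl }
  rw [← e.tsum_eq, ← (Equiv.optionEquivSumPUnit.{0} (α × List α)).symm.tsum_eq,
    ENNReal.summable.tsum_sum ENNReal.summable]
  rw [ENNReal.tsum_prod', add_comm]
  simp [e]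

lemma tsum_wt {d : ℕ} (l : ℕ) (x : Zd d) (F : List (Zd d) → ℝ≥0∞) :
    ∑' b : List (Zd d), (if b.length = l then wt x b * F b else 0) = EL l x F := by
  induction l generalizing x F with
  | zero =>
    rw [tsum_eq_single []]
    · simp [wt, EL]
    · intro b hb
      simp [hb]
  | succ l ih =>
    rw [tsum_list]
    simp only [EL, List.length_nil, List.length_cons, Nat.add_right_cancel_iff]
    rw [if_neg (by omega), zero_add]
    refine tsum_congr fun y => ?_
    rw [← ih, ← ENNReal.tsum_mul_left]
    refine tsum_congr fun b => ?_
    by_cases h : b.length = l <;> simp [h, wt, mul_assoc]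

lemma tsum_len {α : Type*} (H : List α → ℝ≥0∞) :
    ∑' b, H b = ∑' l : ℕ, ∑' b : List α, if b.length = l then H b else 0 := by
  rw [ENNReal.tsum_comm]
  refine tsum_congr fun b => ?_
  rw [tsum_eq_single b.length]
  · simp
  · intro l hl
    simp [hl.symm]

lemma wt_of_chain {d : ℕ} (x : Zd d) (b : List (Zd d)) (h : (x :: b).IsChain IsNN) :
    wt x b = (((2 * d : ℕ) : ℝ≥0∞)⁻¹) ^ b.length := by
  induction b generalizing x with
  | nil => simp [wt]
  | cons y b ih =>
    rw [List.isChain_cons_cons] at h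
    simp [wt, ih y h.2, kk, h.1, pow_succ, mul_comm]

lemma wt_of_not_chain {d : ℕ} (x : Zd d) (b : List (Zd d)) (h : ¬ (x :: b).IsChain IsNN) :
    wt x b = 0 := by
  induction b generalizing x with
  | nil => simp at h
  | cons y b ih =>
    rw [List.isChain_cons_cons] at h
    by_cases h1 : IsNN x y
    · simp [wt, ih y (fun h2 => h ⟨h1, h2⟩)]
    · simp [wt, kk, h1]

/-! ### Part B: the potential and the one-step contraction -/

/-- indicator that `b` avoids `A` -/
def av {d : ℕ} (A : Finset (Zd d)) (b : List (Zd d)) : ℝ≥0∞ := if ∀ y ∈ b, y ∉ A then 1 else 0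

/-- escape probability up to time `m` -/
def esc {d : ℕ} (A : Finset (Zd d)) (x : Zd d) (m : ℕ) : ℝ≥0∞ := EL m x (av A)

/-- the potential -/
def pot {d : ℕ} (aw : ℕ → ℝ≥0∞) (θ : ℝ≥0∞) (A : Finset (Zd d)) : ℝ≥0∞ :=
  ∑ x ∈ A, (∑' m, aw m * esc A x m + θ)

lemma av_le_one {d : ℕ} (A : Finset (Zd d)) (b : List (Zd d)) : av A b ≤ 1 := by
  unfold av; split_ifs <;> simp

lemma av_append {d : ℕ} (A : Finset (Zd d)) (b c : List (Zd d)) :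
    av A (b ++ c) = av A b * av A c := by
  unfold av
  by_cases h1 : ∀ y ∈ b, y ∉ A <;> by_cases h2 : ∀ y ∈ c, y ∉ A
  · rw [if_pos, if_pos h1, if_pos h2, one_mul]
    intro y hy
    rcases List.mem_append.1 hy with h | h
    exacts [h1 y h, h2 y h]
  · rw [if_neg, if_neg h2, mul_zero]
    exact fun h => h2 fun y hy => h y (List.mem_append.2 (Or.inr hy))
  all_goals
    rw [if_neg, if_neg h1, zero_mul]
    exact fun h => h1 fun y hy => h y (List.mem_append.2 (Or.inl hy))

lemma av_anti {d : ℕ} {A B : Finset (Zd d)} (h : A ⊆ B) (b : List (Zd d)) : av B b ≤ av A b := by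
  unfold av
  split_ifs with h1 h2
  · rfl
  · exact absurd (fun y hy hA => h1 y hy (h hA)) h2
  · simp
  · rfl

lemma esc_anti {d : ℕ} {A B : Finset (Zd d)} (h : A ⊆ B) (x : Zd d) (m : ℕ) :
    esc B x m ≤ esc A x m := EL_mono _ _ fun b _ => av_anti h b

lemma esc_le_one {d : ℕ} (hd : 0 < d) (A : Finset (Zd d)) (x : Zd d) (m : ℕ) : esc A x m ≤ 1 := by
  rw [← EL_one hd m x]
  exact EL_mono _ _ fun b _ => av_le_one A b

lemma esc_add_le {d : ℕ} (hd : 0 < d) (A : Finset (Zd d)) (x : Zd d) (m k : ℕ) :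
    esc A x (m + k) ≤ esc A x m := by
  unfold esc
  rw [EL_append]
  refine EL_mono _ _ fun b _ => ?_
  calc EL k (lst x b) (fun c => av A (b ++ c)) ≤ EL k (lst x b) (fun c => av A b * 1) :=
        EL_mono _ _ fun c _ => by rw [av_append]; gcongr; exact av_le_one _ _
    _ = av A b := by rw [EL_const hd]; simp

lemma esc_antitone {d : ℕ} (hd : 0 < d) (A : Finset (Zd d)) (x : Zd d) : Antitone (esc A x) := by
  intro m n h
  obtain ⟨k, rfl⟩ := Nat.exists_eq_add_of_le h
  exact esc_add_le hd A x m k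

lemma pot_union_le {d : ℕ} (aw : ℕ → ℝ≥0∞) (θ : ℝ≥0∞) (A B : Finset (Zd d)) :
    pot aw θ (A ∪ B) ≤ pot aw θ A + pot aw θ B := by
  unfold pot
  have h1 : ∀ C : Finset (Zd d), C ⊆ A ∪ B →
      ∑ x ∈ C, (∑' m, aw m * esc (A ∪ B) x m + θ) ≤ ∑ x ∈ C, (∑' m, aw m * esc C x m + θ) := by
    intro C hC
    refine Finset.sum_le_sum fun x _ => ?_
    gcongr
    exact esc_anti hC _ _
  refine le_trans ?_ (add_le_add (h1 A Finset.subset_union_left) (h1 B Finset.subset_union_right))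
  rw [← Finset.sum_union_inter]
  exact le_self_add

lemma pot_le_card {d : ℕ} (hd : 0 < d) (aw : ℕ → ℝ≥0∞) (θ : ℝ≥0∞) (A : Finset (Zd d)) :
    pot aw θ A ≤ A.card * (∑' m, aw m + θ) := by
  unfold pot
  rw [← nsmul_eq_mul]
  refine Finset.sum_le_card_nsmul _ _ _ fun x _ => ?_
  gcongr with m
  calc aw m * esc A x m ≤ aw m * 1 := by gcongr; exact esc_le_one hd _ _ _
    _ = aw m := mul_one _

/-- potential of the range of the path `x :: b` -/
def potL {d : ℕ} (aw : ℕ → ℝ≥0∞) (θ : ℝ≥0∞) (x : Zd d) (b : List (Zd d)) : ℝ≥0∞ :=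
  pot aw θ (x :: b).toFinset

lemma potL_le {d : ℕ} (hd : 0 < d) (aw : ℕ → ℝ≥0∞) (θ : ℝ≥0∞) (x : Zd d) (b : List (Zd d)) :
    potL aw θ x b ≤ ((b.length : ℝ≥0∞) + 1) * (∑' m, aw m + θ) := by
  refine (pot_le_card hd aw θ _).trans ?_
  gcongr
  have := List.toFinset_card_le (x :: b)
  simp only [List.length_cons] at this
  exact_mod_cast this

lemma pot_append {d : ℕ} (aw : ℕ → ℝ≥0∞) (θ : ℝ≥0∞) (l l' : List (Zd d)) :
    pot aw θ (l ++ l').toFinset ≤ pot aw θ l.toFinset + pot aw θ l'.toFinset := by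
  rw [List.toFinset_append]; exact pot_union_le _ _ _ _

lemma lst_mem {d : ℕ} (x : Zd d) (b : List (Zd d)) : lst x b ∈ x :: b := by
  induction b generalizing x with
  | nil => simp [lst]
  | cons y b ih => exact List.mem_cons_of_mem _ (ih y)

lemma potL_append {d : ℕ} (aw : ℕ → ℝ≥0∞) (θ : ℝ≥0∞) (x : Zd d) (b c : List (Zd d)) :
    potL aw θ x (b ++ c) ≤ potL aw θ x b + potL aw θ (lst x b) c := by
  unfold potL
  have : (x :: (b ++ c)).toFinset = ((x :: b) ++ (lst x b :: c)).toFinset := by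
    ext y
    have := lst_mem x b
    simp only [List.mem_toFinset, List.mem_append, List.mem_cons] at *
    grind
  rw [this]
  exact pot_append _ _ _ _

lemma esc_translate {d : ℕ} (A : Finset (Zd d)) (x z : Zd d) (m : ℕ) :
    esc (A.image (· + z)) (x + z) m = esc A x m := by
  unfold esc
  rw [EL_translate]
  refine EL_congr _ _ fun b _ => ?_
  unfold av
  congr 1
  simp

lemma pot_translate {d : ℕ} (aw : ℕ → ℝ≥0∞) (θ : ℝ≥0∞) (A : Finset (Zd d)) (z : Zd d) :
    pot aw θ (A.image (· + z)) = pot aw θ A := by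
  unfold pot
  rw [Finset.sum_image (fun a _ b _ h => add_right_cancel h)]
  simp only [esc_translate]

lemma EL_potL {d : ℕ} (aw : ℕ → ℝ≥0∞) (θ : ℝ≥0∞) (x : Zd d) (l : ℕ) :
    EL l x (potL aw θ x) = EL l (0 : Zd d) (potL aw θ 0) := by
  have := EL_translate l (0 : Zd d) x (potL aw θ x)
  rw [zero_add] at this
  rw [this]
  refine EL_congr _ _ fun b _ => ?_
  unfold potL
  rw [← pot_translate aw θ (0 :: b).toFinset x]
  congr 1
  ext y
  simp only [List.mem_toFinset, Finset.mem_image, List.mem_cons, List.mem_map]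
  constructor
  · rintro (rfl | ⟨a, ha, rfl⟩)
    · exact ⟨0, Or.inl rfl, by simp⟩
    · exact ⟨a, Or.inr ha, rfl⟩
  · rintro ⟨a, rfl | ha, rfl⟩
    · left; simp
    · exact Or.inr ⟨a, ha, rfl⟩

/-- forward bound -/
lemma fwd_bound {d : ℕ} (hd : 0 < d) (aw : ℕ → ℝ≥0∞) (θ : ℝ≥0∞) (K : ℕ) (hK : 0 < K) (l : ℕ)
    (x : Zd d) :
    EL l x (potL aw θ x) ≤ EL K (0 : Zd d) (potL aw θ 0) / K * l + K * (∑' m, aw m + θ) := by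
  obtain ⟨b0, hb⟩ : ∃ b0, b0 = EL K (0 : Zd d) (potL aw θ 0) := ⟨_, rfl⟩
  rw [← hb]
  have hK0 : (K : ℝ≥0∞) ≠ 0 := by simpa using hK.ne'
  have hKt : (K : ℝ≥0∞) ≠ ∞ := by simp
  induction l using Nat.strong_induction_on generalizing x with
  | _ l ih =>
    by_cases hl : l < K
    · refine le_add_left ?_
      rw [← EL_const hd l x ((K : ℝ≥0∞) * (∑' m, aw m + θ))]
      refine EL_mono _ _ fun c hc => (potL_le hd aw θ x c).trans ?_
      gcongr
      rw [hc]
      exact_mod_cast hl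
    · obtain ⟨k, rfl⟩ := Nat.exists_eq_add_of_le (not_lt.1 hl)
      rw [EL_append]
      calc EL K x (fun b => EL k (lst x b) fun c => potL aw θ x (b ++ c))
          ≤ EL K x (fun b => potL aw θ x b + (b0 / K * k + K * (∑' m, aw m + θ))) := by
            refine EL_mono _ _ fun b _ => ?_
            calc EL k (lst x b) (fun c => potL aw θ x (b ++ c))
                ≤ EL k (lst x b) (fun c => potL aw θ x b + potL aw θ (lst x b) c) :=
                  EL_mono _ _ fun c _ => potL_append _ _ _ _ _
              _ = potL aw θ x b + EL k (lst x b) (potL aw θ (lst x b)) := by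
                  rw [EL_add, EL_const hd]
              _ ≤ _ := by
                  gcongr
                  exact ih k (by omega) _
        _ = b0 + (b0 / K * k + K * (∑' m, aw m + θ)) := by
            rw [EL_add, EL_const hd, EL_potL, ← hb]
        _ = _ := by
            rw [Nat.cast_add, mul_add (b0 / K), ENNReal.div_mul_cancel hK0 hKt, add_assoc]

/-- backward bound -/
lemma bwd_bound {d : ℕ} (hd : 0 < d) (aw : ℕ → ℝ≥0∞) (θ : ℝ≥0∞) (K : ℕ) (hK : 0 < K)
    (A : Finset (Zd d)) (m : ℕ) (x : Zd d) :
    EL m x (fun a => av A a * potL aw θ x a) + EL K (0 : Zd d) (potL aw θ 0) * esc A x m ≤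
      EL K (0 : Zd d) (potL aw θ 0) / K * (∑ i ∈ Finset.range m, esc A x i)
        + 2 * (K + 1) * (∑' m, aw m + θ) := by
  obtain ⟨b, hb⟩ : ∃ b, b = EL K (0 : Zd d) (potL aw θ 0) := ⟨_, rfl⟩
  rw [← hb]
  have hK0 : (K : ℝ≥0∞) ≠ 0 := by simpa using hK.ne'
  have hKt : (K : ℝ≥0∞) ≠ ∞ := by simp
  have hbF : b ≤ (K + 1) * (∑' m, aw m + θ) := by
    rw [hb, ← EL_const hd K (0 : Zd d) (((K : ℝ≥0∞) + 1) * (∑' m, aw m + θ))]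
    refine EL_mono _ _ fun c hc => (potL_le hd aw θ 0 c).trans ?_
    rw [hc]
  induction m using Nat.strong_induction_on with
  | _ m ih =>
    by_cases hl : m < K
    · refine le_add_left ?_
      rw [two_mul, add_mul]
      refine add_le_add ?_ ?_
      · rw [← EL_const hd m x (((K : ℝ≥0∞) + 1) * (∑' m, aw m + θ))]
        refine EL_mono _ _ fun c hc => ?_
        calc av A c * potL aw θ x c ≤ 1 * potL aw θ x c := by gcongr; exact av_le_one _ _
          _ = potL aw θ x c := one_mul _
          _ ≤ _ := (potL_le hd aw θ x c).trans (by rw [hc]; gcongr)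
      · calc b * esc A x m ≤ b * 1 := by gcongr; exact esc_le_one hd _ _ _
          _ ≤ _ := by rw [mul_one]; exact hbF
    · obtain ⟨k, rfl⟩ := Nat.exists_eq_add_of_le' (not_lt.1 hl)
      have h1 : EL (k + K) x (fun a => av A a * potL aw θ x a) ≤
          EL k x (fun a => av A a * potL aw θ x a) + b * esc A x k := by
        rw [EL_append]
        calc _ ≤ EL k x (fun a => av A a * potL aw θ x a + b * av A a) := by
              refine EL_mono _ _ fun a _ => ?_
              calc EL K (lst x a) (fun c => av A (a ++ c) * potL aw θ x (a ++ c))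
                  ≤ EL K (lst x a) (fun c => av A a * potL aw θ x a
                      + av A a * potL aw θ (lst x a) c) := by
                    refine EL_mono _ _ fun c _ => ?_
                    rw [av_append, ← mul_add]
                    calc av A a * av A c * potL aw θ x (a ++ c)
                        ≤ av A a * 1 * (potL aw θ x a + potL aw θ (lst x a) c) := by
                          gcongr
                          · exact av_le_one _ _
                          · exact potL_append _ _ _ _ _
                      _ = _ := by rw [mul_one]
                _ = _ := by rw [EL_add, EL_const hd, EL_mul, EL_potL, ← hb, mul_comm b]
          _ = _ := by rw [EL_add, EL_mul]; rfl
      have h2 : b * esc A x (k + K) ≤ b / K * ∑ i ∈ Finset.range K, esc A x (k + i) := by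
        calc b * esc A x (k + K) = b / K * (K * esc A x (k + K)) := by
              rw [← mul_assoc, ENNReal.div_mul_cancel hK0 hKt]
          _ ≤ _ := by
              gcongr
              have := Finset.card_nsmul_le_sum (Finset.range K) (fun i => esc A x (k + i))
                (esc A x (k + K)) (fun i hi => esc_antitone hd A x (by
                  have := Finset.mem_range.1 hi; omega))
              simpa using this
      have h3 := ih k (by omega)
      rw [Finset.sum_range_add, mul_add]
      calc _ ≤ (EL k x (fun a => av A a * potL aw θ x a) + b * esc A x k)
            + b / K * ∑ i ∈ Finset.range K, esc A x (k + i) := add_le_add h1 h2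
        _ ≤ _ := by
          refine (add_le_add_left h3 _).trans (le_of_eq ?_)
          ring

lemma tsum_add_idx (g : ℕ → ℝ≥0∞) :
    ∑' j : ℕ, ∑' l : ℕ, g (j + l) = ∑' n : ℕ, ((n : ℝ≥0∞) + 1) * g n := by
  rw [← ENNReal.tsum_prod (f := fun j l => g (j + l)),
    ← Equiv.tsum_eq (Finset.HasAntidiagonal.sigmaAntidiagonalEquivProd (A := ℕ)) (fun p : ℕ × ℕ => g (p.1 + p.2)),
    ENNReal.tsum_sigma']
  refine tsum_congr fun n => ?_
  rw [tsum_fintype]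
  have : ∀ c : Finset.HasAntidiagonal.antidiagonal n, g ((Finset.HasAntidiagonal.sigmaAntidiagonalEquivProd (A := ℕ) ⟨n, c⟩).1 +
      (Finset.HasAntidiagonal.sigmaAntidiagonalEquivProd (A := ℕ) ⟨n, c⟩).2) = g n := by
    rintro ⟨c, hc⟩
    simp only [Finset.HasAntidiagonal.sigmaAntidiagonalEquivProd_apply]
    rw [Finset.HasAntidiagonal.mem_antidiagonal.1 hc]
  simp only [this]
  simp

/-- The weights -/
def awt (r : ℕ → ℝ≥0∞) (m : ℕ) : ℝ≥0∞ := 2 * ∑' k : ℕ, (k : ℝ≥0∞) * r (m + k)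

lemma sum_aux (r : ℕ → ℝ≥0∞) (i : ℕ) :
    ∑' j : ℕ, ∑' l : ℕ, r (i + 1 + j + l) = ∑' k : ℕ, (k : ℝ≥0∞) * r (i + k) := by
  have := tsum_add_idx (fun n => r (i + 1 + n))
  simp only [← add_assoc] at this
  rw [this, tsum_eq_zero_add' (f := fun k : ℕ => (k : ℝ≥0∞) * r (i + k)) ENNReal.summable]
  simp only [Nat.cast_zero, zero_mul, zero_add]
  refine tsum_congr fun n => ?_
  push_cast
  rw [add_right_comm, add_assoc]

lemma tsum_lt_shift (i : ℕ) (h : ℕ → ℝ≥0∞) :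
    ∑' m : ℕ, (if i < m then h m else 0) = ∑' j : ℕ, h (i + 1 + j) := by
  have hinj : Function.Injective (fun j : ℕ => i + 1 + j) := fun a b h => by simpa using h
  rw [← hinj.tsum_eq]
  · refine tsum_congr fun j => ?_
    rw [if_pos (by omega)]
  · intro m hm
    have : i < m := by
      by_contra hc
      simp [hc] at hm
    exact ⟨m - (i + 1), by simp; omega⟩

lemma sum_range_esc (r e : ℕ → ℝ≥0∞) :
    ∑' m : ℕ, ∑' l : ℕ, r (m + l) * ∑ i ∈ Finset.range m, e i =
      ∑' i : ℕ, e i * ∑' k : ℕ, (k : ℝ≥0∞) * r (i + k) := by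
  have h1 : ∀ m, ∑' l : ℕ, r (m + l) * ∑ i ∈ Finset.range m, e i =
      ∑' i : ℕ, if i < m then e i * ∑' l, r (m + l) else 0 := by
    intro m
    rw [ENNReal.tsum_mul_right, mul_comm, Finset.sum_mul]
    rw [tsum_eq_sum (f := fun i => if i < m then e i * ∑' l, r (m + l) else 0)
      (s := Finset.range m)]
    · exact Finset.sum_congr rfl fun i hi => by rw [if_pos (Finset.mem_range.1 hi)]
    · intro i hi
      rw [if_neg (by simpa using hi)]
  simp only [h1]
  rw [ENNReal.tsum_comm]
  refine tsum_congr fun i => ?_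
  rw [tsum_lt_shift i (fun m => e i * ∑' l, r (m + l)), ENNReal.tsum_mul_left, sum_aux]

/-- the combinatorial sum -/
lemma comb_sum (r e : ℕ → ℝ≥0∞) :
    ∑' m : ℕ, ∑' l : ℕ, r (m + l) * ((l : ℝ≥0∞) * e m + ∑ i ∈ Finset.range m, e i) =
      ∑' m : ℕ, awt r m * e m := by
  simp only [mul_add, ENNReal.tsum_add]
  rw [sum_range_esc, ← ENNReal.tsum_add]
  refine tsum_congr fun m => ?_
  unfold awt
  have : ∑' l : ℕ, r (m + l) * ((l : ℝ≥0∞) * e m) = e m * ∑' k : ℕ, (k : ℝ≥0∞) * r (m + k) := by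
    rw [← ENNReal.tsum_mul_left]
    exact tsum_congr fun l => by ring
  rw [this]; ring

/-- Sum over two-sided paths -/
lemma two_sided {d : ℕ} (hd : 0 < d) (r : ℕ → ℝ≥0∞) (θ : ℝ≥0∞) (K : ℕ) (hK : 0 < K)
    (A : Finset (Zd d)) (x : Zd d) :
    ∑' a : List (Zd d), ∑' b : List (Zd d), r (a.length + b.length) * wt x a * wt x b *
      (av A a * pot (awt r) θ (a.reverse ++ x :: b).toFinset) ≤
    EL K (0 : Zd d) (potL (awt r) θ 0) / K * (∑' m, awt r m * esc A x m) +
      3 * (K + 1) * (∑' m, awt r m + θ) * ∑' n : ℕ, ((n : ℝ≥0∞) + 1) * r n := by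
  set b0 := EL K (0 : Zd d) (potL (awt r) θ 0) with hb0
  set F := ∑' m, awt r m + θ with hF
  have hpt : ∀ a b : List (Zd d), pot (awt r) θ (a.reverse ++ x :: b).toFinset ≤
      potL (awt r) θ x a + potL (awt r) θ x b := by
    intro a b
    have : (a.reverse ++ x :: b).toFinset = (x :: a).toFinset ∪ (x :: b).toFinset := by
      ext y
      simp
    rw [this]
    exact pot_union_le _ _ _ _
  have key : ∑' a : List (Zd d), ∑' b : List (Zd d), r (a.length + b.length) * wt x a * wt x b *
      (av A a * pot (awt r) θ (a.reverse ++ x :: b).toFinset) ≤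
      ∑' m : ℕ, ∑' l : ℕ, r (m + l) *
        EL m x (fun a => EL l x (fun b => av A a * (potL (awt r) θ x a + potL (awt r) θ x b))) := by
    have hin : ∀ a : List (Zd d), ∑' b : List (Zd d), r (a.length + b.length) * wt x a * wt x b *
      (av A a * pot (awt r) θ (a.reverse ++ x :: b).toFinset) ≤
      ∑' l : ℕ, r (a.length + l) * (wt x a *
        EL l x (fun b => av A a * (potL (awt r) θ x a + potL (awt r) θ x b))) := by
      intro a
      rw [tsum_len]
      refine ENNReal.tsum_le_tsum fun l => ?_
      rw [← tsum_wt, ← ENNReal.tsum_mul_left, ← ENNReal.tsum_mul_left]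
      refine ENNReal.tsum_le_tsum fun b => ?_
      split_ifs with h
      · rw [h]
        calc _ ≤ r (a.length + l) * wt x a * wt x b *
            (av A a * (potL (awt r) θ x a + potL (awt r) θ x b)) := by gcongr; exact hpt a b
          _ = _ := by ring
      · simp
    refine (ENNReal.tsum_le_tsum hin).trans ?_
    rw [tsum_len]
    refine ENNReal.tsum_le_tsum fun m => ?_
    have : ∀ a : List (Zd d), (if a.length = m then ∑' l : ℕ, r (a.length + l) * (wt x a *
        EL l x (fun b => av A a * (potL (awt r) θ x a + potL (awt r) θ x b))) else 0) =
        ∑' l : ℕ, if a.length = m then r (m + l) * (wt x a *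
        EL l x (fun b => av A a * (potL (awt r) θ x a + potL (awt r) θ x b))) else 0 := by
      intro a
      split_ifs with h
      · rw [h]
      · simp
    simp only [this]
    rw [ENNReal.tsum_comm]
    refine ENNReal.tsum_le_tsum fun l => ?_
    rw [← tsum_wt m, ← ENNReal.tsum_mul_left]
    refine ENNReal.tsum_le_tsum fun a => ?_
    split_ifs <;> simp
  refine key.trans ?_
  have hml : ∀ m l : ℕ,
      EL m x (fun a => EL l x (fun b => av A a * (potL (awt r) θ x a + potL (awt r) θ x b))) ≤
      b0 / K * ((l : ℝ≥0∞) * esc A x m + ∑ i ∈ Finset.range m, esc A x i) +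
        3 * (K + 1) * F := by
    intro m l
    have h1 : EL m x (fun a => EL l x (fun b => av A a * (potL (awt r) θ x a + potL (awt r) θ x b)))
        = EL m x (fun a => av A a * potL (awt r) θ x a) + EL l x (potL (awt r) θ x) * esc A x m := by
      have : ∀ a, EL l x (fun b => av A a * (potL (awt r) θ x a + potL (awt r) θ x b)) =
          av A a * potL (awt r) θ x a + EL l x (potL (awt r) θ x) * av A a := by
        intro a
        rw [EL_mul, EL_add, EL_const hd, mul_add, mul_comm (EL l x _)]
      simp only [this]
      rw [EL_add, EL_mul]; rfl
    rw [h1]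
    have h2 := (le_self_add).trans (bwd_bound hd (awt r) θ K hK A m x)
    have h3 : EL l x (potL (awt r) θ x) * esc A x m ≤ (b0 / K * l) * esc A x m + K * F := by
      calc _ ≤ (b0 / K * l + K * F) * esc A x m := by gcongr; exact fwd_bound hd _ _ K hK l x
        _ = (b0 / K * l) * esc A x m + K * F * esc A x m := add_mul _ _ _
        _ ≤ (b0 / K * l) * esc A x m + K * F * 1 := by gcongr; exact esc_le_one hd _ _ _
        _ = _ := by rw [mul_one]
    calc _ ≤ _ := add_le_add h2 h3
      _ ≤ b0 / K * (∑ i ∈ Finset.range m, esc A x i) + 2 * (K + 1) * F +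
          ((b0 / K * l) * esc A x m + (K + 1) * F) := by gcongr; exact le_self_add
      _ = _ := by ring
  calc _ ≤ ∑' m : ℕ, ∑' l : ℕ, r (m + l) *
      (b0 / K * ((l : ℝ≥0∞) * esc A x m + ∑ i ∈ Finset.range m, esc A x i) + 3 * (K + 1) * F) := by
        gcongr with m l
        exact hml m l
    _ = ∑' m : ℕ, ∑' l : ℕ, (b0 / K * (r (m + l) *
        ((l : ℝ≥0∞) * esc A x m + ∑ i ∈ Finset.range m, esc A x i))
        + 3 * (K + 1) * F * r (m + l)) :=
        tsum_congr fun m => tsum_congr fun l => by ring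
    _ = _ := by
      simp only [ENNReal.tsum_add, ENNReal.tsum_mul_left]
      rw [comb_sum, tsum_add_idx]

/-! ### Part C: the main recursive step -/

lemma hit_decomp {d : ℕ} (A : Finset (Zd d)) (η : Traj d) (h : hits η (A : Set (Zd d))) :
    ∃ x ∈ A, ∃ a b : List (Zd d), η = a.reverse ++ x :: b ∧ ∀ y ∈ a, y ∉ A := by
  induction η with
  | nil => obtain ⟨y, hy, _⟩ := h; simp at hy
  | cons z η ih =>
    by_cases hz : z ∈ A
    · exact ⟨z, hz, [], η, by simp, by simp⟩
    · obtain ⟨y, hy, hyA⟩ := h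
      have hy2 : y ∈ η := by
        rcases List.mem_cons.1 hy with rfl | h
        · exact absurd (by simpa using hyA) hz
        · exact h
      obtain ⟨x, hx, a, b, hab, hav⟩ := ih ⟨y, hy2, hyA⟩
      refine ⟨x, hx, a ++ [z], b, by simp [hab], ?_⟩
      intro w hw
      rcases List.mem_append.1 hw with h | h
      · exact hav w h
      · rw [List.mem_singleton.1 h]; exact hz

lemma fri_le_wt {d : ℕ} (u : ℝ) (hu : 0 ≤ u) (ρ : ℕ → ℝ)
    (hmu : 0 ≤ mu 1 ρ) (x : Zd d) (a b : List (Zd d)) :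
    ENNReal.ofReal (friIntensity d u ρ (a.reverse ++ x :: b)) ≤
      ENNReal.ofReal (u / (mu 1 ρ + 1)) *
        (ENNReal.ofReal (ρ (a.length + b.length)) * wt x a * wt x b) := by
  unfold friIntensity
  split_ifs with h
  · have hc : (a.reverse ++ x :: b).IsChain IsNN := h.2
    have hlen : len (a.reverse ++ x :: b) = a.length + b.length := by
      simp [len]
    have hb : (x :: b).IsChain IsNN := hc.right_of_append
    have ha : (x :: a).IsChain IsNN := by
      have h1 : (a.reverse ++ [x]) ++ b = a.reverse ++ x :: b := by simp
      rw [← h1] at hc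
      have h2 := hc.left_of_append
      rw [← List.reverse_cons, List.isChain_reverse] at h2
      exact h2.imp fun _ _ h => isNN_symm h
    rw [wt_of_chain x a ha, wt_of_chain x b hb, hlen, mul_assoc (ENNReal.ofReal (ρ _)), ← pow_add]
    have : u * ρ (a.length + b.length) / (mu 1 ρ + 1) * (1 / (2 * (d : ℝ))) ^ (a.length + b.length)
       = u / (mu 1 ρ + 1) * (ρ (a.length + b.length) * (1 / (2 * (d : ℝ))) ^ (a.length + b.length)) := by
      ring
    rw [this, ENNReal.ofReal_mul (by positivity), ENNReal.ofReal_mul' (by positivity),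
      ENNReal.ofReal_pow (by positivity)]
    gcongr
    rcases Nat.eq_zero_or_pos d with rfl | hd
    · simp
    · rw [one_div, ENNReal.ofReal_inv_of_pos (by positivity)]
      gcongr
      rw [← ENNReal.ofReal_natCast]
      push_cast
      exact le_rfl
  · simp

/-- One-step comparison: the total potential of trajectories hitting `A`. -/
lemma main_step {d : ℕ} (hd : 0 < d) (u : ℝ) (hu : 0 ≤ u) (ρ : ℕ → ℝ)
    (hmu : 0 ≤ mu 1 ρ) (r : ℕ → ℝ≥0∞) (hr : r = fun L => ENNReal.ofReal (ρ L))
    (θ q : ℝ≥0∞) (K : ℕ) (hK : 0 < K)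
    (h1 : ENNReal.ofReal (u / (mu 1 ρ + 1)) * (EL K (0 : Zd d) (potL (awt r) θ 0) / K) ≤ q)
    (h2 : ENNReal.ofReal (u / (mu 1 ρ + 1)) *
      (3 * (K + 1) * (∑' m, awt r m + θ) * ∑' n : ℕ, ((n : ℝ≥0∞) + 1) * r n) ≤ q * θ)
    (A : Finset (Zd d)) :
    ∑' η : Traj d, (if hits η (A : Set (Zd d)) then
      ENNReal.ofReal (friIntensity d u ρ η) * pot (awt r) θ η.toFinset else 0) ≤
      q * pot (awt r) θ A := by
  set c := ENNReal.ofReal (u / (mu 1 ρ + 1)) with hc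
  let f : Traj d → ℝ≥0∞ := fun η => ENNReal.ofReal (friIntensity d u ρ η) * pot (awt r) θ η.toFinset
  let g : A × (List (Zd d) × List (Zd d)) → Traj d := fun p => p.2.1.reverse ++ p.1.1 :: p.2.2
  have key : ∀ η : Traj d, (if hits η (A : Set (Zd d)) then f η else 0) ≤
      ∑' p : A × (List (Zd d) × List (Zd d)), if η = g p then av A p.2.1 * f (g p) else 0 := by
    intro η
    split_ifs with h
    · obtain ⟨x, hx, a, b, hab, hav⟩ := hit_decomp A η h
      refine le_trans ?_ (ENNReal.le_tsum (⟨x, hx⟩, (a, b)))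
      have hg : η = g (⟨x, hx⟩, (a, b)) := hab
      rw [if_pos hg, ← hg]
      have : av A a = 1 := by
        unfold av; rw [if_pos hav]
      rw [this, one_mul]
    · simp
  calc _ ≤ ∑' η : Traj d, ∑' p : A × (List (Zd d) × List (Zd d)),
        (if η = g p then av A p.2.1 * f (g p) else 0) := ENNReal.tsum_le_tsum key
    _ = ∑' p : A × (List (Zd d) × List (Zd d)), av A p.2.1 * f (g p) := by
        rw [ENNReal.tsum_comm]
        refine tsum_congr fun p => ?_
        rw [tsum_ite_eq]
    _ = ∑ x ∈ A, ∑' a, ∑' b, av A a * f (a.reverse ++ x :: b) := by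
        rw [ENNReal.tsum_prod', tsum_fintype, ← Finset.sum_coe_sort A]
        refine Finset.sum_congr rfl fun x _ => ?_
        rw [ENNReal.tsum_prod']
    _ ≤ ∑ x ∈ A, c * ∑' a : List (Zd d), ∑' b : List (Zd d),
          r (a.length + b.length) * wt x a * wt x b *
          (av A a * pot (awt r) θ (a.reverse ++ x :: b).toFinset) := by
        refine Finset.sum_le_sum fun x _ => ?_
        rw [← ENNReal.tsum_mul_left]
        refine ENNReal.tsum_le_tsum fun a => ?_
        rw [← ENNReal.tsum_mul_left]
        refine ENNReal.tsum_le_tsum fun b => ?_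
        have := fri_le_wt u hu ρ hmu x a b
        calc av A a * f (a.reverse ++ x :: b) ≤ av A a * ((c *
            (ENNReal.ofReal (ρ (a.length + b.length)) * wt x a * wt x b)) *
            pot (awt r) θ (a.reverse ++ x :: b).toFinset) := by
              exact mul_le_mul_right (mul_le_mul_left this _) _
          _ = _ := by rw [hr]; ring
    _ ≤ ∑ x ∈ A, c * (EL K (0 : Zd d) (potL (awt r) θ 0) / K * (∑' m, awt r m * esc A x m) +
      3 * (K + 1) * (∑' m, awt r m + θ) * ∑' n : ℕ, ((n : ℝ≥0∞) + 1) * r n) := by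
        gcongr with x hx
        exact two_sided hd r θ K hK A x
    _ ≤ ∑ x ∈ A, q * ((∑' m, awt r m * esc A x m) + θ) := by
        refine Finset.sum_le_sum fun x _ => ?_
        rw [mul_add c, mul_add q, ← mul_assoc]
        exact add_le_add (mul_le_mul_left h1 _) h2
    _ = _ := by rw [pot, Finset.mul_sum]

/-! ### Part D: chains of trajectories and subcriticality -/

/-- A chain of trajectories from the origin; the head is the last one. -/
def ChainOK {d : ℕ} : List (Traj d) → Prop
  | [] => False
  | [η] => hits η (([(0 : Zd d)].toFinset : Finset (Zd d)) : Set (Zd d))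
  | η :: η' :: l => hits η (η'.toFinset : Set (Zd d)) ∧ ChainOK (η' :: l)

lemma chain_sum {d : ℕ} (ι : Traj d → ℝ≥0∞) (p : Finset (Zd d) → ℝ≥0∞) (q : ℝ≥0∞)
    (h : ∀ A : Finset (Zd d), ∑' η : Traj d, (if hits η (A : Set (Zd d)) then
      ι η * p η.toFinset else 0) ≤ q * p A) (k : ℕ) :
    ∑' l : List (Traj d), (if l.length = k + 1 ∧ ChainOK l then
      (l.map ι).prod * p (l.headD []).toFinset else 0) ≤
      q ^ (k + 1) * p [(0 : Zd d)].toFinset := by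
  induction k with
  | zero =>
    rw [tsum_list]
    simp only [List.length_nil, List.length_cons]
    rw [if_neg (by simp), zero_add, zero_add, pow_one]
    refine le_trans (ENNReal.tsum_le_tsum fun η => ?_) (h _)
    rw [tsum_eq_single []]
    · simp [ChainOK]
    · intro l hl
      rw [if_neg]
      simp [hl]
  | succ k ih =>
    rw [tsum_list]
    rw [if_neg (by simp), zero_add, ENNReal.tsum_comm]
    calc _ ≤ ∑' l : List (Traj d), q * (if l.length = k + 1 ∧ ChainOK l then
      (l.map ι).prod * p (l.headD []).toFinset else 0) := by
          refine ENNReal.tsum_le_tsum fun l => ?_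
          rcases l with _ | ⟨η', l⟩
          · simp
          by_cases hl : (η' :: l).length = k + 1 ∧ ChainOK (η' :: l)
          · rw [if_pos hl]
            calc _ = ∑' η : Traj d, ((η' :: l).map ι).prod *
                  (if hits η (η'.toFinset : Set (Zd d)) then ι η * p η.toFinset else 0) := by
                  refine tsum_congr fun η => ?_
                  by_cases hh : hits η (η'.toFinset : Set (Zd d))
                  · rw [if_pos hh, if_pos ⟨by simpa using hl.1, hh, hl.2⟩]
                    simp only [List.map_cons, List.prod_cons, List.headD_cons]
                    ring
                  · rw [if_neg hh, if_neg (fun h => hh h.2.1), mul_zero]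
              _ = _ := ENNReal.tsum_mul_left
              _ ≤ ((η' :: l).map ι).prod * (q * p η'.toFinset) := mul_le_mul_right (h _) _
              _ = _ := by
                  simp only [List.headD_cons]; ring
          · rw [if_neg hl, mul_zero]
            refine le_of_eq (ENNReal.tsum_eq_zero.2 fun η => ?_)
            rw [if_neg]
            rintro ⟨h1, h2⟩
            exact hl ⟨by simpa using h1, h2.2⟩
      _ ≤ _ := by
          rw [ENNReal.tsum_mul_left, pow_succ' q (k + 1), mul_assoc]
          exact mul_le_mul_right ih _

lemma chainOK_head_ne {d : ℕ} (l : List (Traj d)) (h : ChainOK l) : ∃ y, y ∈ l.headD [] := by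
  match l, h with
  | [η], h => obtain ⟨y, hy, _⟩ := h; exact ⟨y, hy⟩
  | η :: η' :: l, h => obtain ⟨y, hy, _⟩ := h.1; exact ⟨y, hy⟩

lemma chain_total {d : ℕ} (ι : Traj d → ℝ≥0∞) (p : Finset (Zd d) → ℝ≥0∞) (q θ : ℝ≥0∞)
    (hq : q < 1) (hθ : θ ≠ 0) (hθ' : θ ≠ ∞)
    (hp : ∀ A : Finset (Zd d), A.Nonempty → θ ≤ p A) (hp0 : p [(0 : Zd d)].toFinset ≠ ∞)
    (h : ∀ A : Finset (Zd d), ∑' η : Traj d, (if hits η (A : Set (Zd d)) then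
      ι η * p η.toFinset else 0) ≤ q * p A) :
    ∑' l : List (Traj d), (if ChainOK l then (l.map ι).prod else 0) ≠ ∞ := by
  have h1 : θ * ∑' l : List (Traj d), (if ChainOK l then (l.map ι).prod else 0) ≤
      ∑' l : List (Traj d), (if ChainOK l then
        (l.map ι).prod * p (l.headD []).toFinset else 0) := by
    rw [← ENNReal.tsum_mul_left]
    refine ENNReal.tsum_le_tsum fun l => ?_
    split_ifs with hl
    · rw [mul_comm]
      gcongr
      apply hp
      obtain ⟨y, hy⟩ := chainOK_head_ne l hl
      exact ⟨y, by simpa using hy⟩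
    · simp
  have h2 : ∑' l : List (Traj d), (if ChainOK l then
        (l.map ι).prod * p (l.headD []).toFinset else 0) ≤
        (∑' k : ℕ, q ^ (k + 1)) * p [(0 : Zd d)].toFinset := by
    rw [tsum_len, tsum_eq_zero_add' ENNReal.summable, ← ENNReal.tsum_mul_right]
    have : ∑' b : List (Traj d), (if b.length = 0 then if ChainOK b then
        (b.map ι).prod * p (b.headD []).toFinset else 0 else 0) = 0 := by
      refine ENNReal.tsum_eq_zero.2 fun b => ?_
      split_ifs with h1 h2
      · rw [List.length_eq_zero_iff.1 h1] at h2
        exact absurd h2 (by simp [ChainOK])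
      · rfl
      · rfl
    rw [this, zero_add]
    refine ENNReal.tsum_le_tsum fun k => ?_
    simp only [← ite_and]
    exact chain_sum ι p q h k
  have h3 : (∑' k : ℕ, q ^ (k + 1)) ≠ ∞ := by
    refine ne_top_of_le_ne_top ?_ (ENNReal.tsum_comp_le_tsum_of_injective
      (Nat.succ_injective) (fun k => q ^ k))
    rw [ENNReal.tsum_geometric]
    exact ENNReal.inv_ne_top.2 (tsub_pos_of_lt hq).ne'
  intro htop
  rw [htop, ENNReal.mul_top hθ] at h1
  exact (ENNReal.mul_ne_top h3 hp0) (top_le_iff.1 (h1.trans h2))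

lemma meas_zero {d : ℕ} (F : Finset (Traj d)) :
    MeasurableSet {ω : Config d | ∀ η ∈ F, ω η = 0} := by
  have : {ω : Config d | ∀ η ∈ F, ω η = 0} = ⋂ η ∈ F, (fun ω : Config d => ω η) ⁻¹' {0} := by
    ext; simp
  rw [this]
  exact Finset.measurableSet_biInter _ fun η _ => measurable_pi_apply η (MeasurableSet.singleton 0)

lemma meas_pos {d : ℕ} (F : Finset (Traj d)) :
    MeasurableSet {ω : Config d | ∀ η ∈ F, 0 < ω η} := by
  have : {ω : Config d | ∀ η ∈ F, 0 < ω η} =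
      ⋂ η ∈ F, (fun ω : Config d => ω η) ⁻¹' (Set.Ioi 0) := by
    ext; simp
  rw [this]
  exact Finset.measurableSet_biInter _ fun η _ => measurable_pi_apply η (measurableSet_Ioi)

lemma poisson_zero_pos {d : ℕ} (ι : Traj d → ℝ) (P : Measure (Config d)) (hP : IsPoissonPP d ι P)
    (G : Finset (Traj d)) : ∀ F : Finset (Traj d), Disjoint F G →
    P ({ω | ∀ η ∈ F, ω η = 0} ∩ {ω | ∀ η ∈ G, 0 < ω η}) =
      (∏ η ∈ F, ENNReal.ofReal (Real.exp (-ι η))) *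
        ∏ η ∈ G, (1 - ENNReal.ofReal (Real.exp (-ι η))) := by
  haveI := hP.1
  induction G using Finset.induction_on with
  | empty =>
    intro F _
    have := hP.2 F (fun _ => 0)
    simp only [Finset.notMem_empty, false_imp_iff, implies_true, Set.setOf_true, Set.inter_univ,
      Finset.prod_empty, mul_one]
    rw [this]
    simp [poissonProb]
  | insert η G hη ih =>
    intro F hF
    rw [Finset.disjoint_insert_right] at hF
    have e : ({ω : Config d | ∀ η ∈ F, ω η = 0} ∩ {ω | ∀ η' ∈ insert η G, 0 < ω η'}) =
        ({ω | ∀ η ∈ F, ω η = 0} ∩ {ω | ∀ η ∈ G, 0 < ω η}) \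
        ({ω | ∀ η' ∈ insert η F, ω η' = 0} ∩ {ω | ∀ η ∈ G, 0 < ω η}) := by
      ext ω
      simp only [Finset.mem_insert, forall_eq_or_imp, Set.mem_inter_iff, Set.mem_setOf_eq,
        Set.mem_diff]
      constructor
      · rintro ⟨h1, h2, h3⟩
        exact ⟨⟨h1, h3⟩, fun h => h2.ne' h.1.1⟩
      · rintro ⟨⟨h1, h2⟩, h3⟩
        refine ⟨h1, Nat.pos_of_ne_zero fun h => h3 ⟨⟨h, h1⟩, h2⟩, h2⟩
    rw [e, measure_diff _ ((meas_zero _).inter (meas_pos _)).nullMeasurableSet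
      (measure_ne_top _ _), ih F hF.2, ih (insert η F) (by
        rw [Finset.disjoint_insert_left]; exact ⟨hη, hF.2⟩)]
    · rw [Finset.prod_insert hF.1, Finset.prod_insert hη]
      set a := ∏ η ∈ F, ENNReal.ofReal (Real.exp (-ι η))
      set b := ∏ η ∈ G, (1 - ENNReal.ofReal (Real.exp (-ι η)))
      have ha : a ≠ ∞ := ENNReal.prod_ne_top fun _ _ => ENNReal.ofReal_ne_top
      have hb : b ≠ ∞ := ENNReal.prod_ne_top fun _ _ => ENNReal.sub_ne_top (by simp)
      have : a * ((1 - ENNReal.ofReal (Real.exp (-ι η))) * b) =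
          (a * b) * (1 - ENNReal.ofReal (Real.exp (-ι η))) := by ring
      rw [this, ENNReal.mul_sub (fun _ _ => ENNReal.mul_ne_top ha hb), mul_one]
      congr 1
      ring
    · refine Set.inter_subset_inter_left _ fun ω h η' h' => h η' (Finset.mem_insert_of_mem h')

lemma poisson_pos {d : ℕ} (ι : Traj d → ℝ) (P : Measure (Config d)) (hP : IsPoissonPP d ι P)
    (G : Finset (Traj d)) : P {ω | ∀ η ∈ G, 0 < ω η} =
        ∏ η ∈ G, (1 - ENNReal.ofReal (Real.exp (-ι η))) := by
  have := poisson_zero_pos ι P hP G ∅ (by simp)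
  simpa using this

lemma chainOK_suffix {d : ℕ} (l : List (Traj d)) (h : ChainOK l) (η : Traj d) (hη : η ∈ l) :
    ∃ l', l' <:+ l ∧ ChainOK l' ∧ l'.headD [] = η := by
  induction l with
  | nil => simp at hη
  | cons ζ l ih =>
    rcases List.mem_cons.1 hη with rfl | h1
    · exact ⟨η :: l, List.suffix_refl _, h, rfl⟩
    · rcases l with _ | ⟨ζ', l⟩
      · simp at h1
      obtain ⟨l', h2, h3, h4⟩ := ih h.2 h1
      exact ⟨l', h2.trans (List.suffix_cons _ _), h3, h4⟩

lemma edgeOpen_mem {d : ℕ} {ω : Config d} {x y : Zd d} (h : EdgeOpen ω x y) :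
    ∃ η : Traj d, 0 < ω η ∧ x ∈ η ∧ y ∈ η := by
  obtain ⟨η, h1, i, ⟨h2, h3⟩ | ⟨h2, h3⟩⟩ := h
  · exact ⟨η, h1, List.mem_of_getElem? h2, List.mem_of_getElem? h3⟩
  · exact ⟨η, h1, List.mem_of_getElem? h3, List.mem_of_getElem? h2⟩

lemma cluster_chain {d : ℕ} (ω : Config d) (y : Zd d) (h : y ∈ Cluster ω 0) :
    y = 0 ∨ ∃ l : List (Traj d), (ChainOK l ∧ l.Nodup ∧ ∀ η ∈ l, 0 < ω η) ∧ y ∈ l.headD [] := by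
  have h' : Relation.ReflTransGen (EdgeOpen ω) 0 y := h
  induction h' with
  | refl => left; rfl
  | @tail y z hy hyz ih =>
    right
    obtain ⟨η, h1, h2, h3⟩ := edgeOpen_mem hyz
    rcases ih hy with rfl | ⟨l, ⟨hl1, hl2, hl3⟩, hyl⟩
    · refine ⟨[η], ⟨⟨0, h2, by simp⟩, by simp, by simpa using h1⟩, by simpa using h3⟩
    · by_cases hη : η ∈ l
      · obtain ⟨l', h4, h5, h6⟩ := chainOK_suffix l hl1 η hη
        refine ⟨l', ⟨h5, hl2.sublist h4.sublist, fun ζ hζ => hl3 ζ (h4.subset hζ)⟩, ?_⟩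
        rw [h6]; exact h3
      · rcases l with _ | ⟨ζ, l⟩
        · simp at hyl
        refine ⟨η :: ζ :: l, ⟨⟨⟨y, h2, by simpa using hyl⟩, hl1⟩, ?_, ?_⟩, by simpa using h3⟩
        · exact List.nodup_cons.2 ⟨hη, hl2⟩
        · intro w hw
          rcases List.mem_cons.1 hw with rfl | hw
          · exact h1
          · exact hl3 w hw

lemma no_perc {d : ℕ} (ι : Traj d → ℝ) (P : Measure (Config d)) (hP : IsPoissonPP d ι P)
    (h : ∑' l : List (Traj d), (if ChainOK l then (l.map (fun η => ENNReal.ofReal (ι η))).prod else 0)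
      ≠ ∞) : P (PercEvent d) = 0 := by
  have hae := ae_finite_setOf_mem (μ := P) (s := fun l : List (Traj d) =>
    {ω : Config d | ChainOK l ∧ l.Nodup ∧ ∀ η ∈ l, 0 < ω η}) (by
      refine ne_top_of_le_ne_top h (ENNReal.tsum_le_tsum fun l => ?_)
      by_cases h1 : ChainOK l ∧ l.Nodup
      · rw [if_pos h1.1]
        have : {ω : Config d | ChainOK l ∧ l.Nodup ∧ ∀ η ∈ l, 0 < ω η} =
            {ω : Config d | ∀ η ∈ l.toFinset, 0 < ω η} := by
          ext ω; simp [h1.1, h1.2]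
        rw [this, poisson_pos ι P hP, ← List.prod_toFinset _ h1.2]
        refine Finset.prod_le_prod' fun η _ => ?_
        rw [← ENNReal.ofReal_one, ← ENNReal.ofReal_sub _ (Real.exp_pos _).le]
        refine ENNReal.ofReal_le_ofReal ?_
        have := Real.add_one_le_exp (-ι η)
        linarith
      · have : {ω : Config d | ChainOK l ∧ l.Nodup ∧ ∀ η ∈ l, 0 < ω η} = ∅ := by
          ext ω
          simp only [Set.mem_setOf_eq, Set.mem_empty_iff_false, iff_false]
          tauto
        rw [this]; simp)
  rw [← nonpos_iff_eq_zero]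
  refine (measure_mono ?_).trans (nonpos_iff_eq_zero.2 hae)
  intro ω hω hfin
  apply hω
  have : Cluster ω 0 ⊆ {0} ∪ ⋃ l ∈ {l : List (Traj d) | ω ∈ {ω : Config d | ChainOK l ∧ l.Nodup ∧
      ∀ η ∈ l, 0 < ω η}}, {y | y ∈ l.headD []} := by
    intro y hy
    rcases cluster_chain ω y hy with rfl | ⟨l, hl, hyl⟩
    · left; rfl
    · right
      simp only [Set.mem_iUnion]
      exact ⟨l, hl, hyl⟩
  refine Set.Finite.subset ?_ this
  refine (Set.finite_singleton _).union (Set.Finite.biUnion hfin fun l _ => ?_)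
  exact List.finite_toSet _

/-! ### Part E: heat kernel bound -/

/-- One-dimensional simple random walk kernel. -/
def gk : ℕ → ℤ → ℝ
  | 0, z => if z = 0 then 1 else 0
  | n + 1, z => (gk n (z - 1) + gk n (z + 1)) / 2

lemma gk_nonneg (n : ℕ) (z : ℤ) : 0 ≤ gk n z := by
  induction n generalizing z with
  | zero => simp only [gk]; split_ifs <;> norm_num
  | succ n ih => simp only [gk]; have := ih (z - 1); have := ih (z + 1); linarith

lemma gk_lt (n : ℕ) (z : ℤ) (h : z < -(n : ℤ)) : gk n z = 0 := by
  induction n generalizing z with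
  | zero =>
    simp only [gk]; rw [if_neg]; rintro rfl; simp at h
  | succ n ih =>
    push_cast at h
    simp only [gk]
    rw [ih _ (by omega), ih _ (by omega)]; norm_num

lemma gk_odd (n : ℕ) (z : ℤ) (h : (z - n) % 2 = 1) : gk n z = 0 := by
  induction n generalizing z with
  | zero =>
    simp only [gk]; rw [if_neg]; rintro rfl; simp at h
  | succ n ih =>
    push_cast at h
    simp only [gk]
    rw [ih _ (by omega), ih _ (by omega)]; norm_num

lemma gk_choose (n k : ℕ) : gk n (2 * k - n) = (n.choose k : ℝ) / 2 ^ n := by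
  induction n generalizing k with
  | zero =>
    rcases k with _ | k
    · simp [gk]
    · simp only [gk]
      rw [if_neg (by push_cast; omega)]
      simp
  | succ n ih =>
    rcases k with _ | k
    · simp only [gk]
      rw [gk_lt n _ (by push_cast; omega)]
      have := ih 0
      have e : (2 * ((0 : ℕ) : ℤ) - ((n + 1 : ℕ) : ℤ) + 1) = 2 * ((0 : ℕ) : ℤ) - n := by
        push_cast; ring
      rw [e, this]
      simp only [Nat.choose_zero_right]
      rw [pow_succ]; field_simp; simp
    · simp only [gk]
      have e1 : (2 * ((k + 1 : ℕ) : ℤ) - ((n + 1 : ℕ) : ℤ) - 1) = 2 * (k : ℤ) - n := by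
        push_cast; ring
      have e2 : (2 * ((k + 1 : ℕ) : ℤ) - ((n + 1 : ℕ) : ℤ) + 1) = 2 * ((k + 1 : ℕ) : ℤ) - n := by
        push_cast; ring
      rw [e1, e2, ih, ih, Nat.choose_succ_succ, pow_succ]
      push_cast
      field_simp

lemma gk_le_choose (n : ℕ) (z : ℤ) : gk n z ≤ (n.choose (n / 2) : ℝ) / 2 ^ n := by
  by_cases h1 : z < -(n : ℤ)
  · rw [gk_lt n z h1]; positivity
  by_cases h2 : (z - n) % 2 = 1
  · rw [gk_odd n z h2]; positivity
  obtain ⟨k, hk⟩ : ∃ k : ℕ, z = 2 * k - n := ⟨((z + n) / 2).toNat, by omega⟩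
  rw [hk, gk_choose]
  gcongr
  exact_mod_cast Nat.choose_le_middle k n

/-- central binomial ratio -/
lemma cb_sq (m : ℕ) : ((m.centralBinom : ℝ) / 2 ^ (2 * m)) ^ 2 ≤ 1 / (2 * m + 1) := by
  induction m with
  | zero => simp
  | succ m ih =>
    have h := Nat.succ_mul_centralBinom_succ m
    have h' : ((m : ℝ) + 1) * ((m + 1).centralBinom : ℝ) = 2 * (2 * m + 1) * (m.centralBinom : ℝ) := by
      exact_mod_cast h
    have e : ((m + 1).centralBinom : ℝ) / 2 ^ (2 * (m + 1)) =
        ((m.centralBinom : ℝ) / 2 ^ (2 * m)) * ((2 * m + 1) / (2 * m + 2)) := by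
      have : ((m + 1).centralBinom : ℝ) = 2 * (2 * m + 1) * (m.centralBinom : ℝ) / (m + 1) := by
        rw [← h']; field_simp
      rw [this, show 2 * (m + 1) = 2 * m + 2 by ring, pow_add]
      field_simp
    rw [e, mul_pow]
    calc _ ≤ (1 / (2 * (m : ℝ) + 1)) * ((2 * m + 1) / (2 * m + 2)) ^ 2 := by gcongr
      _ ≤ _ := by
        push_cast
        rw [div_pow, div_mul_div_comm, div_le_div_iff₀ (by positivity) (by positivity)]
        have : (0 : ℝ) ≤ m := Nat.cast_nonneg m
        nlinarith [mul_nonneg this this, mul_nonneg (mul_nonneg this this) this]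

lemma gk_even_le (m : ℕ) (z : ℤ) : gk (2 * m) z ≤ (m.centralBinom : ℝ) / 2 ^ (2 * m) := by
  have := gk_le_choose (2 * m) z
  rwa [Nat.mul_div_cancel_left _ (by norm_num)] at this

lemma gk_even_sq (m : ℕ) (z : ℤ) : gk (2 * m) z ^ 2 ≤ 1 / (2 * m + 1) := by
  refine le_trans ?_ (cb_sq m)
  have := gk_nonneg (2 * m) z
  gcongr
  exact gk_even_le m z

lemma gk_sq (n : ℕ) (z : ℤ) : gk n z ^ 2 ≤ 4 / (n + 3) := by
  rcases Nat.even_or_odd' n with ⟨m, rfl | rfl⟩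
  · refine (gk_even_sq m z).trans ?_
    push_cast
    rw [div_le_div_iff₀ (by positivity) (by positivity)]
    have : (0 : ℝ) ≤ m := Nat.cast_nonneg m
    linarith
  · have h1 : gk (2 * m + 1) z ≤ (m.centralBinom : ℝ) / 2 ^ (2 * m) := by
      simp only [gk]
      have := gk_even_le m (z - 1)
      have := gk_even_le m (z + 1)
      linarith
    have h0 := gk_nonneg (2 * m + 1) z
    calc gk (2 * m + 1) z ^ 2 ≤ ((m.centralBinom : ℝ) / 2 ^ (2 * m)) ^ 2 := by gcongr
      _ ≤ 1 / (2 * (m : ℝ) + 1) := cb_sq m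
      _ ≤ _ := by
        push_cast
        rw [div_le_div_iff₀ (by positivity) (by positivity)]
        have : (0 : ℝ) ≤ m := Nat.cast_nonneg m
        linarith

lemma gk_le_one (n : ℕ) (z : ℤ) : gk n z ≤ 1 := by
  have h := gk_sq n z
  induction n generalizing z with
  | zero => simp only [gk]; split_ifs <;> norm_num
  | succ n ih =>
    simp only [gk]
    have := ih (z - 1) (gk_sq _ _)
    have := ih (z + 1) (gk_sq _ _)
    linarith

lemma conv_step (y q : ℝ) (hy : 3 ≤ y) (hq0 : 0 ≤ q) :
    q * (1 / (y + 1) ^ 2) + (1 - q) * (1 / y ^ 2) ≤ 1 / (y + q / 2) ^ 2 := by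
  have h1 : 1 / y ^ 2 - q / y ^ 3 ≤ 1 / (y + q / 2) ^ 2 := by
    have hyp : 0 < y := by linarith
    rw [div_sub_div _ _ (by positivity) (by positivity), div_le_div_iff₀ (by positivity) (by positivity)]
    have e : 1 * (y ^ 2 * y ^ 3) - (1 * y ^ 3 - y ^ 2 * q) * (y + q / 2) ^ 2
       = y ^ 2 * q ^ 2 * (3 / 4 * y + q / 4) := by ring
    have : 0 ≤ y ^ 2 * q ^ 2 * (3 / 4 * y + q / 4) := by positivity
    linarith
  have h2 : 1 / y ^ 3 ≤ 1 / y ^ 2 - 1 / (y + 1) ^ 2 := by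
    have hyp : 0 < y := by linarith
    rw [div_sub_div _ _ (by positivity) (by positivity), div_le_div_iff₀ (by positivity) (by positivity)]
    have : 0 ≤ y ^ 2 * (y ^ 2 - y - 1) := by
      apply mul_nonneg (by positivity); nlinarith
    nlinarith
  have h3 : q * (1 / y ^ 3) ≤ q * (1 / y ^ 2 - 1 / (y + 1) ^ 2) := by gcongr
  have h4 : q / y ^ 3 = q * (1 / y ^ 3) := by ring
  rw [h4] at h1
  linarith

/-- product kernel -/
def fk {d : ℕ} (n : Fin d → ℕ) (x : Zd d) : ℝ := ∏ i, gk (n i) (x i)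

lemma fk_nonneg {d : ℕ} (n : Fin d → ℕ) (x : Zd d) : 0 ≤ fk n x :=
  Finset.prod_nonneg fun _ _ => gk_nonneg _ _

lemma fk_step {d : ℕ} (n : Fin d → ℕ) (x : Zd d) (i : Fin d) :
    fk n (x + stepv (i, true)) + fk n (x + stepv (i, false)) =
      2 * fk (Function.update n i (n i + 1)) x := by
  unfold fk
  rw [← Finset.mul_prod_erase Finset.univ _ (Finset.mem_univ i),
    ← Finset.mul_prod_erase Finset.univ (fun j => gk (n j) ((x + stepv (i, false)) j))
      (Finset.mem_univ i),
    ← Finset.mul_prod_erase Finset.univ (fun j => gk (Function.update n i (n i + 1) j) (x j))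
      (Finset.mem_univ i)]
  have e : ∀ b : Bool, ∏ j ∈ Finset.univ.erase i, gk (n j) ((x + stepv (i, b)) j) =
      ∏ j ∈ Finset.univ.erase i, gk (n j) (x j) := by
    intro b
    refine Finset.prod_congr rfl fun j hj => ?_
    have : j ≠ i := Finset.ne_of_mem_erase hj
    simp [stepv, Pi.single_eq_of_ne this]
  have e2 : ∏ j ∈ Finset.univ.erase i, gk (Function.update n i (n i + 1) j) (x j) =
      ∏ j ∈ Finset.univ.erase i, gk (n j) (x j) := by
    refine Finset.prod_congr rfl fun j hj => ?_
    have : j ≠ i := Finset.ne_of_mem_erase hj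
    simp [Function.update_of_ne this]
  rw [e, e, e2]
  simp only [Function.update_self, gk, stepv, Pi.add_apply, Pi.single_eq_same, if_true]
  rw [show x i - 1 = x i + -1 by ring]
  simp only [Bool.false_eq_true, if_false]
  ring

/-- comparison function -/
def Hk {d : ℕ} (hd : 4 ≤ d) (t : ℕ) (n : Fin d → ℕ) : ℝ :=
  4 * ∑ j : Fin 4, 1 / ((n (Fin.castLE hd j) : ℝ) + t / (2 * d) + 3) ^ 2

lemma Hk_step {d : ℕ} (hd : 4 ≤ d) (t : ℕ) (n : Fin d → ℕ) :
    (1 / (d : ℝ)) * ∑ i : Fin d, Hk hd t (Function.update n i (n i + 1)) ≤ Hk hd (t + 1) n := by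
  have hd0 : (0 : ℝ) < d := by exact_mod_cast (by omega : 0 < d)
  unfold Hk
  rw [← Finset.mul_sum, Finset.sum_comm, mul_left_comm, Finset.mul_sum]
  gcongr with j _
  set c := Fin.castLE hd j
  set y : ℝ := (n c : ℝ) + t / (2 * d) + 3 with hy
  have hy3 : 3 ≤ y := by
    have : (0 : ℝ) ≤ (n c : ℝ) + t / (2 * d) := by positivity
    linarith
  have e : ∑ i : Fin d, 1 / ((Function.update n i (n i + 1) c : ℝ) + t / (2 * d) + 3) ^ 2 =
      1 / (y + 1) ^ 2 + (d - 1) * (1 / y ^ 2) := by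
    rw [← Finset.add_sum_erase _ _ (Finset.mem_univ c)]
    congr 1
    · rw [Function.update_self, hy]; push_cast; congr 2; ring
    · rw [Finset.sum_congr rfl (g := fun _ => 1 / y ^ 2)]
      · rw [Finset.sum_const, Finset.card_erase_of_mem (Finset.mem_univ _), Finset.card_univ,
          Fintype.card_fin, nsmul_eq_mul, Nat.cast_sub (by omega)]
        simp
      · intro i hi
        rw [Function.update_of_ne (Finset.ne_of_mem_erase hi).symm]
  rw [e]
  have h := conv_step y (1 / d) hy3 (by positivity)
  have e2 : (n c : ℝ) + ((t + 1 : ℕ) : ℝ) / (2 * d) + 3 = y + 1 / d / 2 := by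
    rw [hy]; push_cast; field_simp; ring
  rw [e2]
  refine le_trans (le_of_eq ?_) h
  field_simp

lemma amgm4 (a b c d : ℝ) (A B C D : ℝ) (ha : a ^ 2 ≤ A) (hb : b ^ 2 ≤ B)
    (hc : c ^ 2 ≤ C) (hd : d ^ 2 ≤ D) :
    a * b * c * d ≤ (A ^ 2 + B ^ 2 + C ^ 2 + D ^ 2) / 4 := by
  have h1 : a ^ 2 * a ^ 2 ≤ A * A := mul_le_mul ha ha (sq_nonneg _) ((sq_nonneg _).trans ha)
  have h2 : b ^ 2 * b ^ 2 ≤ B * B := mul_le_mul hb hb (sq_nonneg _) ((sq_nonneg _).trans hb)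
  have h3 : c ^ 2 * c ^ 2 ≤ C * C := mul_le_mul hc hc (sq_nonneg _) ((sq_nonneg _).trans hc)
  have h4 : d ^ 2 * d ^ 2 ≤ D * D := mul_le_mul hd hd (sq_nonneg _) ((sq_nonneg _).trans hd)
  nlinarith [sq_nonneg (a * b - c * d), sq_nonneg (a ^ 2 - b ^ 2), sq_nonneg (c ^ 2 - d ^ 2)]

lemma fk_base {d : ℕ} (hd : 4 ≤ d) (n : Fin d → ℕ) (x : Zd d) : fk n x ≤ Hk hd 0 n := by
  unfold fk Hk
  have hinj : Function.Injective (Fin.castLE hd) := Fin.castLE_injective hd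
  have h1 : ∏ i, gk (n i) (x i) ≤
      ∏ i ∈ Finset.univ.image (Fin.castLE hd), gk (n i) (x i) := by
    rw [← Finset.prod_mul_prod_compl (Finset.univ.image (Fin.castLE hd))]
    refine mul_le_of_le_one_right (Finset.prod_nonneg fun _ _ => gk_nonneg _ _) ?_
    exact Finset.prod_le_one (fun _ _ => gk_nonneg _ _) (fun _ _ => gk_le_one _ _)
  refine h1.trans ?_
  rw [Finset.prod_image (fun a _ b _ h => hinj h), Fin.prod_univ_four, Fin.sum_univ_four]
  refine (amgm4 _ _ _ _ _ _ _ _ (gk_sq _ _) (gk_sq _ _) (gk_sq _ _) (gk_sq _ _)).trans (le_of_eq ?_)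
  simp only [Nat.cast_zero, zero_div, add_zero, div_pow]
  ring

lemma lst_append {d : ℕ} (x : Zd d) (b c : List (Zd d)) : lst x (b ++ c) = lst (lst x b) c := by
  induction b generalizing x with
  | nil => rfl
  | cons y b ih => exact ih y

lemma EL_sum {d : ℕ} {ι : Type*} [Fintype ι] (l : ℕ) (x : Zd d) (F : ι → List (Zd d) → ℝ≥0∞) :
    EL l x (fun b => ∑ i, F i b) = ∑ i, EL l x (F i) := by
  have := EL_tsum l x F
  simpa only [tsum_fintype] using this

lemma heat_aux {d : ℕ} (hd : 4 ≤ d) (t : ℕ) (n : Fin d → ℕ) (x z : Zd d) :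
    EL t x (fun b => ENNReal.ofReal (fk n (lst x b - z))) ≤ ENNReal.ofReal (Hk hd t n) := by
  have hd0 : (0 : ℝ) < d := by exact_mod_cast (by omega : 0 < d)
  induction t generalizing n with
  | zero => exact ENNReal.ofReal_le_ofReal (fk_base hd n _)
  | succ t ih =>
    rw [EL_append]
    have h1 : ∀ b : List (Zd d), EL 1 (lst x b) (fun c => ENNReal.ofReal (fk n (lst x (b ++ c) - z)))
        = ∑ i : Fin d, ENNReal.ofReal (1 / d) *
          ENNReal.ofReal (fk (Function.update n i (n i + 1)) (lst x b - z)) := by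
      intro b
      simp only [EL, lst_append]
      rw [kk_tsum (lst x b) (fun y => ENNReal.ofReal (fk n (lst (lst x b) [y] - z))),
        Fintype.sum_prod_type]
      refine Finset.sum_congr rfl fun i _ => ?_
      rw [Fintype.sum_bool]
      simp only [lst]
      rw [← mul_add, ← ENNReal.ofReal_add (fk_nonneg _ _) (fk_nonneg _ _), add_sub_right_comm,
        add_sub_right_comm, fk_step, ENNReal.ofReal_mul (by norm_num), ← mul_assoc]
      congr 1
      rw [← ENNReal.ofReal_natCast, ← ENNReal.ofReal_inv_of_pos (by push_cast; positivity),
        ← ENNReal.ofReal_mul (by positivity)]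
      congr 1
      push_cast
      field_simp
    simp only [h1]
    rw [EL_sum]
    simp only [EL_mul]
    calc _ ≤ ∑ i : Fin d, ENNReal.ofReal (1 / d) *
          ENNReal.ofReal (Hk hd t (Function.update n i (n i + 1))) := by
          gcongr with i _
          exact ih _
      _ = ENNReal.ofReal ((1 / d) * ∑ i : Fin d, Hk hd t (Function.update n i (n i + 1))) := by
          rw [ENNReal.ofReal_mul (by positivity), ENNReal.ofReal_sum_of_nonneg, Finset.mul_sum]
          intro i _
          unfold Hk
          positivity
      _ ≤ _ := ENNReal.ofReal_le_ofReal (Hk_step hd t n)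

/-- Heat kernel bound. -/
lemma heat {d : ℕ} (hd : 4 ≤ d) (t : ℕ) (ht : 0 < t) (x z : Zd d) :
    EL t x (fun b => if lst x b = z then 1 else 0) ≤ ENNReal.ofReal (64 * d ^ 2 / t ^ 2) := by
  have hd0 : (0 : ℝ) < d := by exact_mod_cast (by omega : 0 < d)
  have ht0 : (0 : ℝ) < t := by exact_mod_cast ht
  refine le_trans (le_of_eq (EL_congr _ _ fun b _ => ?_)) ((heat_aux hd t (fun _ => 0) x z).trans
    (ENNReal.ofReal_le_ofReal ?_))
  · unfold fk
    simp only [gk, Pi.sub_apply]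
    split_ifs with h
    · simp [h]
    · obtain ⟨i, hi⟩ := Function.ne_iff.1 h
      rw [Finset.prod_eq_zero (Finset.mem_univ i)]
      · simp
      · rw [if_neg (by omega)]
  · unfold Hk
    simp only [Finset.sum_const, Finset.card_univ, Fintype.card_fin, nsmul_eq_mul]
    have : (1 : ℝ) / (((0 : ℕ) : ℝ) + t / (2 * d) + 3) ^ 2 ≤ 1 / (t / (2 * d)) ^ 2 := by
      gcongr
      push_cast; linarith
    calc _ ≤ 4 * (((4 : ℕ) : ℝ) * (1 / (t / (2 * d)) ^ 2)) := by gcongr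
      _ = _ := by push_cast; field_simp; norm_num

/-! ### Part F: link with the path measures -/

/-- initial segment of a path -/
def seg {d : ℕ} (T : ℕ) (ω : ℕ → Zd d) : List (Zd d) := (List.range (T + 1)).map ω

lemma seg_eq_iff {d : ℕ} (T : ℕ) (ω : ℕ → Zd d) (l : List (Zd d)) (hl : l.length = T + 1) :
    seg T ω = l ↔ ∀ t ≤ T, ω t = l.getD t 0 := by
  unfold seg
  constructor
  · rintro rfl t ht
    rw [List.getD_eq_getElem _ _ (by simp; omega)]
    simp
  · intro h
    refine List.ext_getElem (by simp [hl]) fun i h1 h2 => ?_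
    simp only [List.getElem_map, List.getElem_range]
    rw [h i (by simp at h1; omega), List.getD_eq_getElem _ _ h2]

lemma seg_meas {d : ℕ} (T : ℕ) : @Measurable _ _ _ (⊤ : MeasurableSpace (List (Zd d)))
    (seg (d := d) T) := by
  let _ : MeasurableSpace (List (Zd d)) := ⊤
  refine measurable_to_countable' fun l => ?_
  by_cases hl : l.length = T + 1
  · have : seg T ⁻¹' {l} = ⋂ t ∈ Finset.range (T + 1), (fun ω : ℕ → Zd d => ω t) ⁻¹' {l.getD t 0} := by
      ext ω
      simp only [Set.mem_preimage, Set.mem_singleton_iff, seg_eq_iff T ω l hl, Set.mem_iInter,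
        Finset.mem_range, Nat.lt_succ_iff]
    rw [this]
    exact Finset.measurableSet_biInter _ fun t _ => measurable_pi_apply t (MeasurableSet.singleton _)
  · have : seg T ⁻¹' {l} = ∅ := by
      ext ω
      simp only [Set.mem_preimage, Set.mem_singleton_iff, Set.mem_empty_iff_false, iff_false]
      rintro rfl
      simp [seg] at hl
    rw [this]; exact MeasurableSet.empty

lemma seg_prob {d : ℕ} (x : Zd d) (P : Measure (ℕ → Zd d)) (hP : IsSRW d x P) (T : ℕ)
    (y : Zd d) (b : List (Zd d)) :
    P (seg T ⁻¹' {y :: b}) = if y = x then (if b.length = T then wt x b else 0) else 0 := by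
  by_cases hl : b.length = T
  · have e : seg T ⁻¹' {y :: b} = {ω : ℕ → Zd d | ∀ t ≤ T, ω t = (y :: b).getD t 0} := by
      ext ω
      exact seg_eq_iff T ω (y :: b) (by simp [hl])
    rw [e, hP.2 T (fun t => (y :: b).getD t 0), if_pos hl]
    simp only [List.getD_cons_zero]
    by_cases hy : y = x
    · subst hy
      rw [if_pos rfl]
      have hch : (∀ t < T, IsNN ((y :: b).getD t 0) ((y :: b).getD (t + 1) 0)) ↔
          (y :: b).IsChain IsNN := by
        rw [List.isChain_iff_getElem]
        constructor
        · intro h i hi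
          have := h i (by simp at hi; omega)
          rwa [List.getD_eq_getElem _ _ (by omega), List.getD_eq_getElem _ _ hi] at this
        · intro h t ht
          rw [List.getD_eq_getElem _ _ (by simp; omega), List.getD_eq_getElem _ _ (by simp; omega)]
          exact h t (by simp; omega)
      by_cases hc : (y :: b).IsChain IsNN
      · rw [if_pos ⟨rfl, hch.2 hc⟩, wt_of_chain _ _ hc, hl]
      · rw [if_neg (fun h => hc (hch.1 h.2)), wt_of_not_chain _ _ hc]
    · rw [if_neg (fun h => hy h.1), if_neg hy]
  · rw [if_neg hl, ite_self]
    have : seg T ⁻¹' {y :: b} = (∅ : Set (ℕ → Zd d)) := by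
      ext ω
      simp only [Set.mem_preimage, Set.mem_singleton_iff, Set.mem_empty_iff_false, iff_false]
      intro h
      apply hl
      have := congrArg List.length h
      simp [seg] at this
      omega
    rw [this]; simp

lemma link {d : ℕ} (x : Zd d) (P : Measure (ℕ → Zd d)) (hP : IsSRW d x P) (T : ℕ)
    (G : List (Zd d) → ℝ≥0∞) :
    ∫⁻ ω, G (seg T ω) ∂P = EL T x (fun b => G (x :: b)) := by
  let _ : MeasurableSpace (List (Zd d)) := ⊤
  have hG : Measurable G := fun _ _ => trivial
  rw [← lintegral_map hG (seg_meas T), lintegral_countable', tsum_list]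
  have h0 : (P.map (seg T)) {[]} = 0 := by
    rw [Measure.map_apply (seg_meas T) trivial]
    have : seg T ⁻¹' {[]} = (∅ : Set (ℕ → Zd d)) := by
      ext ω; simp [seg]
    rw [this]; simp
  rw [h0, mul_zero, zero_add, tsum_eq_single x]
  · rw [← tsum_wt]
    refine tsum_congr fun b => ?_
    rw [Measure.map_apply (seg_meas T) trivial, seg_prob x P hP, if_pos rfl]
    split_ifs
    · rw [mul_comm]
    · simp
  · intro y hy
    refine ENNReal.tsum_eq_zero.2 fun b => ?_
    rw [Measure.map_apply (seg_meas T) trivial, seg_prob x P hP, if_neg hy, mul_zero]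

lemma seg_set_meas {d : ℕ} (T : ℕ) (S : Set (List (Zd d))) :
    MeasurableSet {ω : ℕ → Zd d | seg T ω ∈ S} := by
  let _ : MeasurableSpace (List (Zd d)) := ⊤
  exact seg_meas T (trivial : MeasurableSet S)

lemma link_set {d : ℕ} (x : Zd d) (P : Measure (ℕ → Zd d)) (hP : IsSRW d x P) (T : ℕ)
    (S : Set (List (Zd d))) :
    P {ω | seg T ω ∈ S} = EL T x (fun b => if x :: b ∈ S then 1 else 0) := by
  rw [← link x P hP T (fun l => if l ∈ S then 1 else 0), ← lintegral_indicator_one (seg_set_meas T S)]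
  rfl

lemma lst_getLastD {d : ℕ} (x z : Zd d) (b : List (Zd d)) : (x :: b).getLastD z = lst x b := by
  induction b generalizing x z with
  | nil => rfl
  | cons y b ih => exact ih y x

lemma hit_prob {d : ℕ} (hd : 4 ≤ d) (x y : Zd d) (P : Measure (ℕ → Zd d)) (hP : IsSRW d x P) (t : ℕ)
    (ht : 0 < t) : P {ω | ω t = y} ≤ ENNReal.ofReal (64 * d ^ 2 / t ^ 2) := by
  have := link_set x P hP t {l | l.getLastD 0 = y}
  have e : {ω : ℕ → Zd d | seg t ω ∈ {l : List (Zd d) | l.getLastD 0 = y}} = {ω | ω t = y} := by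
    ext ω
    simp [seg, List.range_succ]
  rw [e] at this
  rw [this]
  refine le_trans (le_of_eq (EL_congr _ _ fun b _ => ?_)) (heat hd t ht x y)
  have : x :: b ∈ {l : List (Zd d) | l.getLastD 0 = y} ↔ lst x b = y := by
    rw [← lst_getLastD x 0 b]; exact Iff.rfl
  by_cases h : lst x b = y
  · rw [if_pos h, if_pos (this.2 h)]
  · rw [if_neg h, if_neg (fun h' => h (this.1 h'))]

lemma tail_sum (C : ℝ) (hC : 0 ≤ C) (M : ℕ) (hM : 0 < M) :
    ∑' s : ℕ, ENNReal.ofReal (C / ((M + 1 + s : ℕ) : ℝ) ^ 2) ≤ ENNReal.ofReal (C / M) := by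
  refine ENNReal.tsum_le_of_sum_range_le fun N => ?_
  rw [← ENNReal.ofReal_sum_of_nonneg (fun _ _ => by positivity)]
  refine ENNReal.ofReal_le_ofReal ?_
  have hM0 : (0 : ℝ) < M := by exact_mod_cast hM
  have : ∑ s ∈ Finset.range N, C / ((M + 1 + s : ℕ) : ℝ) ^ 2 ≤ C / M - C / (M + N) := by
    induction N with
    | zero => simp
    | succ N ih =>
      rw [Finset.sum_range_succ]
      have h : C / ((M + 1 + N : ℕ) : ℝ) ^ 2 ≤ C / (M + N) - C / (M + N + 1) := by
        have e : C / ((M : ℝ) + N) - C / (M + N + 1) = C / ((M + N) * (M + N + 1)) := by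
          field_simp
          ring
        rw [e]
        push_cast
        gcongr
        nlinarith [Nat.cast_nonneg (α := ℝ) N]
      push_cast at *
      rw [← add_assoc]
      linarith
  have h2 : 0 ≤ C / ((M : ℝ) + N) := by positivity
  linarith

lemma esc_le_noReturn {d : ℕ} (hd : 4 ≤ d) (x : Zd d) (P : Measure (ℕ → Zd d)) (hP : IsSRW d x P)
    (A : Finset (Zd d)) (M : ℕ) (hM : 0 < M) :
    esc A x M ≤ P (NoReturn (A : Set (Zd d))) + A.card * ENNReal.ofReal (64 * d ^ 2 / M) := by
  have h1 : esc A x M = P {ω | seg M ω ∈ {l : List (Zd d) | ∀ y ∈ l.tail, y ∉ A}} := by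
    rw [link_set x P hP]
    refine EL_congr _ _ fun b _ => ?_
    unfold av
    have e : x :: b ∈ {l : List (Zd d) | ∀ y ∈ l.tail, y ∉ A} ↔ ∀ y ∈ b, y ∉ A := Iff.rfl
    by_cases h : ∀ y ∈ b, y ∉ A
    · rw [if_pos h, if_pos (e.2 h)]
    · rw [if_neg h, if_neg (fun h' => h (e.1 h'))]
  have h2 : {ω : ℕ → Zd d | seg M ω ∈ {l : List (Zd d) | ∀ y ∈ l.tail, y ∉ A}} ⊆
      NoReturn (A : Set (Zd d)) ∪ ⋃ y ∈ A, ⋃ s : ℕ, {ω | ω (M + 1 + s) = y} := by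
    intro ω hω
    by_cases h : ω ∈ NoReturn (A : Set (Zd d))
    · left; exact h
    · right
      have h' : ∃ t, 0 < t ∧ ω t ∈ A := by
        by_contra hcon
        push Not at hcon
        exact h fun t ht => by simpa using hcon t ht
      obtain ⟨t, ht, htA⟩ := h'
      have htM : M < t := by
        by_contra hcon
        refine hω (ω t) ?_ htA
        have : seg M ω = ω 0 :: (List.range M).map (fun i => ω (i + 1)) := by
          simp [seg, List.range_succ_eq_map, Function.comp_def]
        rw [this, List.tail_cons, List.mem_map]
        exact ⟨t - 1, List.mem_range.2 (by omega), by congr 1; omega⟩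
      simp only [Set.mem_iUnion]
      refine ⟨ω t, htA, t - (M + 1), ?_⟩
      change ω (M + 1 + (t - (M + 1))) = ω t
      congr 1; omega
  rw [h1]
  refine (measure_mono h2).trans ((measure_union_le _ _).trans (add_le_add le_rfl ?_))
  refine (measure_biUnion_finset_le _ _).trans ?_
  rw [← nsmul_eq_mul]
  refine Finset.sum_le_card_nsmul _ _ _ fun y _ => ?_
  refine (measure_iUnion_le _).trans (le_trans (ENNReal.tsum_le_tsum fun s => ?_)
    (tail_sum (64 * d ^ 2) (by positivity) M hM))
  exact hit_prob hd x y P hP (M + 1 + s) (by omega)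

/-- capacity in extended reals -/
def capE {d : ℕ} (P : Zd d → Measure (ℕ → Zd d)) (A : Finset (Zd d)) : ℝ≥0∞ :=
  ∑ x ∈ A, P x (NoReturn (A : Set (Zd d)))

lemma capE_eq {d : ℕ} (P : Zd d → Measure (ℕ → Zd d)) (hP : IsSRWFamily d P) (A : Finset (Zd d)) :
    ENNReal.ofReal (capacity P A) = capE P A := by
  unfold capacity capE
  rw [ENNReal.ofReal_sum_of_nonneg]
  · refine Finset.sum_congr rfl fun x hx => ?_
    have := (hP x).1
    unfold equil
    rw [if_pos (by simpa using hx), ENNReal.ofReal_toReal (measure_ne_top _ _)]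
  · intro x _
    unfold equil
    split_ifs <;> simp

lemma capE_le {d : ℕ} (P : Zd d → Measure (ℕ → Zd d)) (hP : IsSRWFamily d P) (A : Finset (Zd d)) :
    capE P A ≤ A.card := by
  unfold capE
  have : (A.card : ℝ≥0∞) = A.card • (1 : ℝ≥0∞) := by simp
  rw [this]
  refine Finset.sum_le_card_nsmul _ _ _ fun x _ => ?_
  have := (hP x).1
  exact prob_le_one

lemma cap_link {d : ℕ} (hd : 0 < d) (P : Zd d → Measure (ℕ → Zd d)) (hP : IsSRWFamily d P) (K : ℕ) :
    EL K (0 : Zd d) (fun b => capE P (0 :: b).toFinset) = ENNReal.ofReal (capExpect P K) := by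
  have hw : ∀ ω : ℕ → Zd d, walkRange ω 0 K = (seg K ω).toFinset := by
    intro ω
    ext y
    simp [walkRange, seg, Nat.lt_succ_iff]
  unfold capExpect
  simp only [hw]
  have hnn : ∀ A, 0 ≤ capacity P A := by
    intro A
    refine Finset.sum_nonneg fun x _ => ?_
    unfold equil
    split_ifs <;> simp
  rw [integral_eq_lintegral_of_nonneg_ae (Eventually.of_forall fun ω => hnn _)]
  · simp only [capE_eq P hP]
    have hl := link 0 (P 0) (hP 0) K (fun l => capE P l.toFinset)
    rw [hl, ENNReal.ofReal_toReal]
    refine ne_top_of_le_ne_top (b := ((K + 1 : ℕ) : ℝ≥0∞)) (by simp) ?_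
    rw [← EL_const hd K (0 : Zd d) ((K + 1 : ℕ) : ℝ≥0∞)]
    refine EL_mono _ _ fun b hb => (capE_le P hP _).trans ?_
    have := List.toFinset_card_le (0 :: b)
    rw [List.length_cons, hb] at this
    exact_mod_cast this
  · let _ : MeasurableSpace (List (Zd d)) := ⊤
    have : Measurable (fun l : List (Zd d) => capacity P l.toFinset) := fun _ _ => trivial
    exact (this.comp (seg_meas K)).aestronglyMeasurable

lemma pot_bound {d : ℕ} (hd : 4 ≤ d) (P : Zd d → Measure (ℕ → Zd d)) (hP : IsSRWFamily d P)
    (aw : ℕ → ℝ≥0∞) (a0 : ℝ≥0∞) (ha : ∀ m, aw m ≤ a0) (θ : ℝ≥0∞) (M : ℕ) (hM : 0 < M)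
    (A : Finset (Zd d)) :
    pot aw θ A ≤ A.card * (M * a0 + θ) +
      (∑' m, aw m) * (capE P A + A.card ^ 2 * ENNReal.ofReal (64 * d ^ 2 / M)) := by
  have hd0 : 0 < d := by omega
  unfold pot capE
  have hx : ∀ x ∈ A, ∑' m, aw m * esc A x m + θ ≤ (M * a0 + θ) +
      (∑' m, aw m) * (P x (NoReturn (A : Set (Zd d))) + A.card * ENNReal.ofReal (64 * d ^ 2 / M)) := by
    intro x _
    have h1 : ∑' m, aw m * esc A x m ≤ M * a0 + (∑' m, aw m) * esc A x M := by
      rw [← Summable.sum_add_tsum_nat_add' (f := fun m => aw m * esc A x m) (k := M) ENNReal.summable]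
      refine add_le_add ?_ ?_
      · have : (M : ℝ≥0∞) * a0 = (Finset.range M).card • a0 := by simp
        rw [this]
        refine Finset.sum_le_card_nsmul _ _ _ fun m _ => ?_
        calc aw m * esc A x m ≤ a0 * 1 := mul_le_mul' (ha m) (esc_le_one hd0 _ _ _)
          _ = a0 := mul_one _
      · calc ∑' m, aw (m + M) * esc A x (m + M) ≤ ∑' m, aw (m + M) * esc A x M := by
              gcongr with m
              exact esc_antitone hd0 A x (by omega)
          _ = (∑' m, aw (m + M)) * esc A x M := ENNReal.tsum_mul_right
          _ ≤ _ := mul_le_mul_left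
              (ENNReal.tsum_comp_le_tsum_of_injective (add_left_injective M) aw) _
    have h2 := esc_le_noReturn hd x (P x) (hP x) A M hM
    calc _ ≤ M * a0 + (∑' m, aw m) * esc A x M + θ := by gcongr
      _ ≤ M * a0 + (∑' m, aw m) * (P x (NoReturn (A : Set (Zd d))) +
          A.card * ENNReal.ofReal (64 * d ^ 2 / M)) + θ := by gcongr
      _ = _ := by ring
  refine (Finset.sum_le_sum hx).trans (le_of_eq ?_)
  simp only [Finset.sum_add_distrib, ← Finset.mul_sum, Finset.sum_const, nsmul_eq_mul]
  ring

lemma b_bound {d : ℕ} (hd : 4 ≤ d) (P : Zd d → Measure (ℕ → Zd d)) (hP : IsSRWFamily d P)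
    (aw : ℕ → ℝ≥0∞) (a0 : ℝ≥0∞) (ha : ∀ m, aw m ≤ a0) (θ : ℝ≥0∞) (M : ℕ) (hM : 0 < M) (K : ℕ) :
    EL K (0 : Zd d) (potL aw θ 0) ≤ (K + 1) * (M * a0 + θ) +
      (∑' m, aw m) * (ENNReal.ofReal (capExpect P K) +
        (K + 1) ^ 2 * ENNReal.ofReal (64 * d ^ 2 / M)) := by
  have hd0 : 0 < d := by omega
  calc _ ≤ EL K (0 : Zd d) (fun b => ((K + 1) * (M * a0 + θ) +
      (∑' m, aw m) * ((K + 1) ^ 2 * ENNReal.ofReal (64 * d ^ 2 / M))) +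
      (∑' m, aw m) * capE P (0 :: b).toFinset) := by
        refine EL_mono _ _ fun b hb => ?_
        refine (pot_bound hd P hP aw a0 ha θ M hM _).trans ?_
        have hc : ((0 :: b).toFinset.card : ℝ≥0∞) ≤ K + 1 := by
          have := List.toFinset_card_le (0 :: b)
          rw [List.length_cons, hb] at this
          exact_mod_cast this
        calc _ ≤ (K + 1) * (M * a0 + θ) + (∑' m, aw m) * (capE P (0 :: b).toFinset +
              (K + 1) ^ 2 * ENNReal.ofReal (64 * d ^ 2 / M)) := by gcongr
          _ = _ := by ring
    _ = _ := by
        rw [EL_add, EL_const hd0, EL_mul, cap_link hd0 P hP]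
        ring


/-! ### Percolation at large intensity -/

/-- sign of a boolean -/
def sg (b : Bool) : ℤ := if b then 1 else -1

/-- macroscopic step -/
def sgv (s : Fin 3 → Bool) : Fin 3 → ℤ := fun i => sg (s i)

/-- heat kernel of the difference walk -/
def gg (t : ℕ) (D : Fin 3 → ℤ) : ℝ := ∏ i, gk (2 * t) (D i)

lemma gg_nonneg (t : ℕ) (D : Fin 3 → ℤ) : 0 ≤ gg t D := Finset.prod_nonneg fun _ _ => gk_nonneg _ _

lemma gg_succ (t : ℕ) (D : Fin 3 → ℤ) :
    64 * gg (t + 1) D = ∑ s, ∑ s', gg t (D + sgv s - sgv s') := by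
  unfold gg
  have h1 : ∀ s : Fin 3 → Bool, ∑ s' : Fin 3 → Bool, ∏ i, gk (2 * t) ((D + sgv s - sgv s') i) =
      ∏ i, ∑ b : Bool, gk (2 * t) (D i + sg (s i) - sg b) := by
    intro s
    rw [Finset.prod_univ_sum, Fintype.piFinset_univ]
    rfl
  simp only [h1]
  have h2 : ∑ s : Fin 3 → Bool, ∏ i, ∑ b : Bool, gk (2 * t) (D i + sg (s i) - sg b) =
      ∏ i, ∑ a : Bool, ∑ b : Bool, gk (2 * t) (D i + sg a - sg b) := by
    rw [Finset.prod_univ_sum (t := fun _ => Finset.univ)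
      (f := fun i a => ∑ b : Bool, gk (2 * t) (D i + sg a - sg b)), Fintype.piFinset_univ]
  rw [h2]
  have h3 : ∀ z : ℤ, ∑ a : Bool, ∑ b : Bool, gk (2 * t) (z + sg a - sg b) =
      4 * gk (2 * (t + 1)) z := by
    intro z
    have e : 2 * (t + 1) = 2 * t + 1 + 1 := by ring
    rw [e]
    simp only [gk, Fintype.sum_bool, sg]
    norm_num
    ring_nf
  simp only [h3]
  rw [Finset.prod_mul_distrib]
  norm_num

/-- Green function of the difference walk -/
def GG (D : Fin 3 → ℤ) : ℝ≥0∞ := ∑' t, ENNReal.ofReal (gg t D)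

lemma GG_eq (D : Fin 3 → ℤ) :
    64 * GG D = (if D = 0 then 64 else 0) + ∑ s, ∑ s', GG (D + sgv s - sgv s') := by
  have h0 : GG D = (if D = 0 then 1 else 0) + ∑' t, ENNReal.ofReal (gg (t + 1) D) := by
    unfold GG
    rw [tsum_eq_zero_add' ENNReal.summable]
    congr 1
    by_cases h : D = 0
    · rw [if_pos h, h]; simp [gg, gk]
    · rw [if_neg h]
      obtain ⟨i, hi⟩ := Function.ne_iff.1 h
      have : gg 0 D = 0 := Finset.prod_eq_zero (Finset.mem_univ i) (by simpa [gk] using hi)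
      rw [this]; simp
  have h1 : 64 * ∑' t, ENNReal.ofReal (gg (t + 1) D) = ∑ s, ∑ s', GG (D + sgv s - sgv s') := by
    rw [← ENNReal.tsum_mul_left]
    unfold GG
    have : ∀ t, 64 * ENNReal.ofReal (gg (t + 1) D) =
        ∑ s, ∑ s', ENNReal.ofReal (gg t (D + sgv s - sgv s')) := by
      intro t
      have e : (64 : ℝ≥0∞) = ENNReal.ofReal 64 := by simp
      rw [e, ← ENNReal.ofReal_mul (by norm_num), gg_succ,
        ENNReal.ofReal_sum_of_nonneg (fun s _ => Finset.sum_nonneg fun s' _ => gg_nonneg _ _)]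
      refine Finset.sum_congr rfl fun s _ => ?_
      rw [ENNReal.ofReal_sum_of_nonneg (fun s' _ => gg_nonneg _ _)]
    simp only [this]
    rw [Summable.tsum_finsetSum (fun _ _ => ENNReal.summable)]
    refine Finset.sum_congr rfl fun s _ => ?_
    rw [Summable.tsum_finsetSum (fun _ _ => ENNReal.summable)]
  rw [h0, mul_add, h1]
  congr 1
  split_ifs <;> simp

lemma GG_zero : GG 0 ≠ ∞ := by
  have hs : Summable (fun t : ℕ => (1 / ((t + 1 : ℕ) : ℝ)) ^ (3 / 2 : ℝ)) := by
    have := (Real.summable_one_div_nat_rpow (p := 3 / 2)).2 (by norm_num)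
    have := (summable_nat_add_iff 1).2 this
    refine this.congr fun t => ?_
    rw [Real.div_rpow (by norm_num) (by positivity), Real.one_rpow]
  have hs2 : Summable (fun t => gg t 0) := by
    refine Summable.of_nonneg_of_le (fun t => gg_nonneg t 0) (fun t => ?_) hs
    have e : gg t 0 = (gk (2 * t) 0 ^ 2) ^ (3 / 2 : ℝ) := by
      unfold gg
      rw [← Real.rpow_natCast, ← Real.rpow_mul (gk_nonneg _ _)]
      norm_num [Fin.prod_univ_three]
    rw [e]
    refine Real.rpow_le_rpow (by positivity) ((gk_even_sq t 0).trans ?_) (by norm_num)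
    push_cast
    gcongr
    linarith [Nat.cast_nonneg (α := ℝ) t]
  unfold GG
  rw [← ENNReal.ofReal_tsum_of_nonneg (fun t => gg_nonneg t 0) hs2]
  exact ENNReal.ofReal_ne_top

/-- embedding of the macroscopic lattice -/
def emb (d : ℕ) (D : Fin 3 → ℤ) (k : ℤ) : Zd d := fun i =>
  if h : i.1 < 3 then D ⟨i.1, h⟩ else if i.1 = 3 then k else 0

lemma emb_k {d : ℕ} (hd : 4 ≤ d) (D : Fin 3 → ℤ) (k : ℤ) : emb d D k ⟨3, by omega⟩ = k := by
  simp [emb]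

lemma emb_D {d : ℕ} (hd : 4 ≤ d) (D : Fin 3 → ℤ) (k : ℤ) (i : Fin 3) :
    emb d D k ⟨i.1, by omega⟩ = D i := by
  simp [emb, i.2]

lemma emb_nn1 {d : ℕ} (hd : 4 ≤ d) (D : Fin 3 → ℤ) (k : ℤ) : IsNN (emb d D k) (emb d D (k + 1)) := by
  rw [isNN_iff]
  refine ⟨(⟨3, by omega⟩, true), ?_⟩
  funext i
  by_cases h : i = ⟨3, by omega⟩
  · subst h; simp [emb, stepv]
  · have h3 : i.1 ≠ 3 := fun h' => h (Fin.ext h')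
    simp [emb, stepv, Pi.single_eq_of_ne h, h3]

lemma emb_nn2 {d : ℕ} (hd : 4 ≤ d) (D : Fin 3 → ℤ) (k : ℤ) (j : Fin 3) (b : Bool) :
    IsNN (emb d D k) (emb d (D + Pi.single j (sg b)) k) := by
  rw [isNN_iff]
  refine ⟨(⟨j.1, by omega⟩, b), ?_⟩
  funext i
  by_cases h : i = ⟨j.1, by omega⟩
  · subst h; simp [emb, stepv, sg, j.2]
  · have h3 : i.1 ≠ j.1 := fun h' => h (Fin.ext h')
    simp only [emb, stepv, Pi.add_apply, Pi.single_eq_of_ne h, add_zero]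
    split_ifs with h4
    · rw [Pi.single_eq_of_ne]
      · simp
      · intro h5; exact h3 (by rw [← h5])
    · rfl
    · rfl

/-- oscillating path -/
def osc {d : ℕ} (x y : Zd d) : ℕ → List (Zd d)
  | 0 => []
  | n + 1 => x :: osc y x n

lemma osc_length {d : ℕ} (x y : Zd d) (n : ℕ) : (osc x y n).length = n := by
  induction n generalizing x y with
  | zero => rfl
  | succ n ih => simp [osc, ih]

lemma osc_chain {d : ℕ} (x y : Zd d) (h : IsNN x y) (n : ℕ) : (y :: osc x y n).Chain' IsNN := by
  induction n generalizing x y with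
  | zero => exact List.isChain_singleton _
  | succ n ih => exact List.IsChain.cons_cons (isNN_symm h) (ih y x (isNN_symm h))

/-- macroscopic edge, realised as a trajectory of length `m + 4` -/
def tau (d m : ℕ) (D : Fin 3 → ℤ) (k : ℤ) (s : Fin 3 → Bool) : Traj d :=
  emb d D k :: emb d (D + Pi.single 0 (sg (s 0))) k ::
    emb d (D + Pi.single 0 (sg (s 0)) + Pi.single 1 (sg (s 1))) k ::
    emb d (D + sgv s) k :: emb d (D + sgv s) (k + 1) ::
    osc (emb d (D + sgv s) k) (emb d (D + sgv s) (k + 1)) m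

lemma sgv_eq (D : Fin 3 → ℤ) (s : Fin 3 → Bool) : D + sgv s =
    D + Pi.single 0 (sg (s 0)) + Pi.single 1 (sg (s 1)) + Pi.single 2 (sg (s 2)) := by
  funext i
  fin_cases i <;> simp [sgv]

lemma tau_len (d m : ℕ) (D : Fin 3 → ℤ) (k : ℤ) (s : Fin 3 → Bool) : len (tau d m D k s) = m + 4 := by
  simp [len, tau, osc_length]

lemma tau_chain {d : ℕ} (hd : 4 ≤ d) (m : ℕ) (D : Fin 3 → ℤ) (k : ℤ) (s : Fin 3 → Bool) :
    (tau d m D k s).Chain' IsNN := by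
  unfold tau
  refine List.IsChain.cons_cons (emb_nn2 hd _ _ _ _) (List.IsChain.cons_cons (emb_nn2 hd _ _ _ _)
    (List.IsChain.cons_cons ?_ (List.IsChain.cons_cons (emb_nn1 hd _ _)
    (osc_chain _ _ (emb_nn1 hd _ _) m))))
  rw [sgv_eq]
  exact emb_nn2 hd _ _ _ _

lemma tau_path {d : ℕ} (m : ℕ) (D : Fin 3 → ℤ) (k : ℤ) (s : Fin 3 → Bool)
    (ω : Config d) (h : 0 < ω (tau d m D k s)) :
    Relation.ReflTransGen (EdgeOpen ω) (emb d D k) (emb d (D + sgv s) (k + 1)) := by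
  have e : ∀ i x y, (tau d m D k s)[i]? = some x → (tau d m D k s)[i + 1]? = some y →
      EdgeOpen ω x y := fun i x y h1 h2 => ⟨_, h, i, Or.inl ⟨h1, h2⟩⟩
  exact (((Relation.ReflTransGen.single (e 0 _ _ rfl rfl)).tail (e 1 _ _ rfl rfl)).tail
    (e 2 _ _ rfl rfl)).tail (e 3 _ _ rfl rfl)

lemma sgv_inj {s s' : Fin 3 → Bool} (h : sgv s = sgv s') : s = s' := by
  funext i
  have := congrFun h i
  simp only [sgv, sg] at this
  revert this
  cases s i <;> cases s' i <;> simp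

lemma emb_inj {d : ℕ} (hd : 4 ≤ d) {D D' : Fin 3 → ℤ} {k k' : ℤ} (h : emb d D k = emb d D' k') :
    D = D' ∧ k = k' := by
  constructor
  · funext i
    rw [← emb_D hd D k, h, emb_D hd]
  · rw [← emb_k hd D k, h, emb_k hd]

lemma tau_inj {d : ℕ} (hd : 4 ≤ d) (m : ℕ) {D D' : Fin 3 → ℤ} {k k' : ℤ} {s s' : Fin 3 → Bool}
    (h : tau d m D k s = tau d m D' k' s') : D = D' ∧ k = k' ∧ s = s' := by
  unfold tau at h
  simp only [List.cons.injEq] at h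
  obtain ⟨h1, h2⟩ := emb_inj hd h.1
  obtain ⟨h3, h4⟩ := emb_inj hd h.2.2.2.1
  subst h1
  exact ⟨rfl, h2, sgv_inj (add_left_cancel h3)⟩


/-- trajectories of a macroscopic path -/
def FF (d m : ℕ) : (Fin 3 → ℤ) → ℤ → List (Fin 3 → Bool) → Finset (Traj d)
  | _, _, [] => ∅
  | D, k, s :: w => insert (tau d m D k s) (FF d m (D + sgv s) (k + 1) w)

lemma FF_mem {d m : ℕ} (w : List (Fin 3 → Bool)) (D : Fin 3 → ℤ) (k : ℤ) (η : Traj d)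
    (h : η ∈ FF d m D k w) : ∃ D' k' s, k ≤ k' ∧ η = tau d m D' k' s := by
  induction w generalizing D k with
  | nil => simp [FF] at h
  | cons s w ih =>
    rw [FF, Finset.mem_insert] at h
    rcases h with h | h
    · exact ⟨D, k, s, le_rfl, h⟩
    · obtain ⟨D', k', s', h1, h2⟩ := ih _ _ h
      exact ⟨D', k', s', by omega, h2⟩

lemma FF_notMem {d : ℕ} (hd : 4 ≤ d) {m : ℕ} (w : List (Fin 3 → Bool)) (D D' : Fin 3 → ℤ) (k : ℤ)
    (s : Fin 3 → Bool) : tau d m D' k s ∉ FF d m D (k + 1) w := by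
  intro h
  obtain ⟨D1, k1, s1, h1, h2⟩ := FF_mem w _ _ _ h
  have := (tau_inj hd m h2).2.1
  omega

lemma FF_card {d : ℕ} (hd : 4 ≤ d) {m : ℕ} (w : List (Fin 3 → Bool)) (D : Fin 3 → ℤ) (k : ℤ) :
    (FF d m D k w).card = w.length := by
  induction w generalizing D k with
  | nil => rfl
  | cons s w ih => rw [FF, Finset.card_insert_of_notMem (FF_notMem hd _ _ _ _ _), ih]; rfl

lemma FF_take {d m : ℕ} (w : List (Fin 3 → Bool)) (j : ℕ) (D : Fin 3 → ℤ) (k : ℤ) :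
    FF d m D k (w.take j) ⊆ FF d m D k w := by
  induction w generalizing D k j with
  | nil => simp
  | cons s w ih =>
    cases j with
    | zero => simp [FF]
    | succ j =>
      rw [List.take_succ_cons, FF, FF]
      exact Finset.insert_subset_insert _ (ih _ _ _)

lemma FF_union {d : ℕ} (hd : 4 ≤ d) {m : ℕ} (w w' : List (Fin 3 → Bool)) (D D' : Fin 3 → ℤ) (k : ℤ)
    (s s' : Fin 3 → Bool) :
    (FF d m D k (s :: w) ∪ FF d m D' k (s' :: w')).card =
      (FF d m (D + sgv s) (k + 1) w ∪ FF d m (D' + sgv s') (k + 1) w').card +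
        if D = D' ∧ s = s' then 1 else 2 := by
  rw [FF, FF, Finset.insert_union, Finset.union_insert]
  have h1 : tau d m D k s ∉ FF d m (D + sgv s) (k + 1) w ∪ FF d m (D' + sgv s') (k + 1) w' := by
    rw [Finset.mem_union]
    rintro (h | h) <;> exact FF_notMem hd _ _ _ _ _ h
  have h2 : tau d m D' k s' ∉ FF d m (D + sgv s) (k + 1) w ∪ FF d m (D' + sgv s') (k + 1) w' := by
    rw [Finset.mem_union]
    rintro (h | h) <;> exact FF_notMem hd _ _ _ _ _ h
  by_cases h : D = D' ∧ s = s'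
  · rw [if_pos h, h.1, h.2, Finset.insert_idem, Finset.card_insert_of_notMem]
    rw [h.1, h.2] at h1
    exact h1
  · rw [if_neg h, Finset.card_insert_of_notMem, Finset.card_insert_of_notMem h2]
    rw [Finset.mem_insert]
    rintro (h' | h')
    · exact h ⟨(tau_inj hd m h').1, (tau_inj hd m h').2.2⟩
    · exact h1 h'

/-- sum over words of length `n` -/
def SW : ℕ → (List (Fin 3 → Bool) → ℝ≥0∞) → ℝ≥0∞
  | 0, f => f []
  | n + 1, f => ∑ s, SW n (fun w => f (s :: w))

lemma SW_congr (n : ℕ) (f g : List (Fin 3 → Bool) → ℝ≥0∞) (h : ∀ w, w.length = n → f w = g w) :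
    SW n f = SW n g := by
  induction n generalizing f g with
  | zero => exact h [] rfl
  | succ n ih =>
    exact Finset.sum_congr rfl fun s _ => ih _ _ fun w hw => h _ (by rw [List.length_cons, hw])

lemma SW_const (n : ℕ) (c : ℝ≥0∞) : SW n (fun _ => c) = 8 ^ n * c := by
  induction n with
  | zero => simp [SW]
  | succ n ih => simp [SW, ih, pow_succ]; ring

lemma SW_mul (n : ℕ) (c : ℝ≥0∞) (f : List (Fin 3 → Bool) → ℝ≥0∞) :
    SW n (fun w => c * f w) = c * SW n f := by
  induction n generalizing f with
  | zero => simp [SW]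
  | succ n ih => simp only [SW, ih]; rw [Finset.mul_sum]

lemma SW_sum {ι : Type*} (n : ℕ) (S : Finset ι) (f : ι → List (Fin 3 → Bool) → ℝ≥0∞) :
    SW n (fun w => ∑ i ∈ S, f i w) = ∑ i ∈ S, SW n (f i) := by
  induction n generalizing f with
  | zero => simp [SW]
  | succ n ih => simp only [SW, ih]; rw [Finset.sum_comm]

lemma SW_pos (n : ℕ) (f : List (Fin 3 → Bool) → ℝ≥0∞) (h : SW n f ≠ 0) :
    ∃ w, w.length = n ∧ f w ≠ 0 := by
  by_contra hc
  push Not at hc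
  apply h
  rw [SW_congr n f (fun _ => 0) (fun w hw => hc w hw), SW_const]; simp

lemma SW_meas {Ω : Type*} [MeasurableSpace Ω] (n : ℕ) (f : Ω → List (Fin 3 → Bool) → ℝ≥0∞)
    (hf : ∀ w, Measurable fun ω => f ω w) : Measurable fun ω => SW n (f ω) := by
  induction n generalizing f with
  | zero => exact hf []
  | succ n ih => exact Finset.measurable_sum _ fun s _ => ih _ fun w => hf _

lemma SW_lint {Ω : Type*} [MeasurableSpace Ω] (P : Measure Ω) (n : ℕ)
    (f : Ω → List (Fin 3 → Bool) → ℝ≥0∞)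
    (hf : ∀ w, Measurable fun ω => f ω w) :
    ∫⁻ ω, SW n (f ω) ∂P = SW n (fun w => ∫⁻ ω, f ω w ∂P) := by
  induction n generalizing f with
  | zero => rfl
  | succ n ih =>
    simp only [SW]
    rw [lintegral_finset_sum _ fun s _ => SW_meas n _ fun w => hf _]
    exact Finset.sum_congr rfl fun s _ => ih _ fun w => hf _

/-- second moment bound -/
lemma second_moment {d : ℕ} (hd : 4 ≤ d) (m : ℕ) (p r : ℝ≥0∞) (hpr : p + r = 1)
    (hr : r * (1 + GG 0) ≤ 8 * p) (n : ℕ) (D D' : Fin 3 → ℤ) (k : ℤ) :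
    SW n (fun w => SW n (fun w' => p ^ (FF d m D k w ∪ FF d m D' k w').card)) ≤
      (8 * p) ^ (2 * n) * (1 + GG (D - D')) := by
  induction n generalizing D D' k with
  | zero => simp [SW, FF]
  | succ n ih =>
    have hp2 : p = p ^ 2 + p * r := by
      calc p = p * (p + r) := by rw [hpr, mul_one]
        _ = _ := by ring
    have e1 : SW (n + 1) (fun w => SW (n + 1) (fun w' =>
        p ^ (FF d m D k w ∪ FF d m D' k w').card)) =
        ∑ s, ∑ s', p ^ (if D = D' ∧ s = s' then 1 else 2) *
          SW n (fun w => SW n (fun w' =>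
            p ^ (FF d m (D + sgv s) (k + 1) w ∪ FF d m (D' + sgv s') (k + 1) w').card)) := by
      simp only [SW]
      refine Finset.sum_congr rfl fun s _ => ?_
      rw [SW_sum]
      refine Finset.sum_congr rfl fun s' _ => ?_
      rw [← SW_mul]
      refine SW_congr _ _ _ fun w _ => ?_
      rw [← SW_mul]
      refine SW_congr _ _ _ fun w' _ => ?_
      rw [FF_union hd, pow_add, mul_comm]
    rw [e1]
    have e2 : ∀ s s' : Fin 3 → Bool, p ^ (if D = D' ∧ s = s' then 1 else 2) =
        p ^ 2 + (if D = D' ∧ s = s' then p * r else 0) := by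
      intro s s'
      split_ifs
      · rw [pow_one]; exact hp2
      · simp
    calc _ ≤ ∑ s, ∑ s', (p ^ 2 + (if D = D' ∧ s = s' then p * r else 0)) *
          ((8 * p) ^ (2 * n) * (1 + GG (D - D' + sgv s - sgv s'))) := by
          refine Finset.sum_le_sum fun s _ => Finset.sum_le_sum fun s' _ => ?_
          rw [e2 s s']
          refine mul_le_mul_right ((ih _ _ _).trans (le_of_eq ?_)) _
          congr 3
          abel
      _ = (8 * p) ^ (2 * n) * (p ^ 2 * ∑ s, ∑ s', (1 + GG (D - D' + sgv s - sgv s')) +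
          ∑ s, ∑ s', (if D = D' ∧ s = s' then p * r else 0) * (1 + GG (D - D' + sgv s - sgv s'))) := by
          simp only [Finset.mul_sum, mul_add (( 8 * p) ^ (2 * n)), ← Finset.sum_add_distrib]
          refine Finset.sum_congr rfl fun s _ => Finset.sum_congr rfl fun s' _ => ?_
          ring
      _ ≤ (8 * p) ^ (2 * n) * (p ^ 2 * ∑ s, ∑ s', (1 + GG (D - D' + sgv s - sgv s')) +
          p ^ 2 * (if D - D' = 0 then 64 else 0)) := by
          refine mul_le_mul_right (add_le_add le_rfl ?_) _
          by_cases h : D = D'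
          · have h' : D - D' = 0 := sub_eq_zero.2 h
            rw [if_pos h', h']
            have : ∀ s : Fin 3 → Bool, ∑ s', (if D = D' ∧ s = s' then p * r else 0) *
                (1 + GG (0 + sgv s - sgv s')) = p * r * (1 + GG 0) := by
              intro s
              rw [Finset.sum_eq_single s]
              · rw [if_pos ⟨h, rfl⟩]; simp
              · intro s' _ hs
                rw [if_neg (fun hh => hs hh.2.symm), zero_mul]
              · simp
            simp only [this]
            rw [Finset.sum_const]
            have : (Finset.univ : Finset (Fin 3 → Bool)).card = 8 := by simp
            rw [this, nsmul_eq_mul]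
            calc ((8 : ℕ) : ℝ≥0∞) * (p * r * (1 + GG 0)) = 8 * p * (r * (1 + GG 0)) := by
                  push_cast; ring
              _ ≤ 8 * p * (8 * p) := mul_le_mul_right hr _
              _ = _ := by ring
          · rw [Finset.sum_eq_zero]
            · exact zero_le
            · intro s _
              refine Finset.sum_eq_zero fun s' _ => ?_
              rw [if_neg (fun hh => h hh.1), zero_mul]
      _ = _ := by
          have := GG_eq (D - D')
          have h64 : ∑ s : Fin 3 → Bool, ∑ s', (1 + GG (D - D' + sgv s - sgv s')) =
              64 + ∑ s, ∑ s', GG (D - D' + sgv s - sgv s') := by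
            simp only [Finset.sum_add_distrib]
            congr 1
            simp
            norm_num
          rw [h64, ← mul_add, add_assoc, add_comm (∑ s, ∑ s', GG (D - D' + sgv s - sgv s')), ← this]
          ring

lemma two_mul_le_sq (a b : ℝ≥0∞) : 2 * (a * b) ≤ a ^ 2 + b ^ 2 := by
  rcases le_total a b with h | h
  · obtain ⟨c, rfl⟩ := exists_add_of_le h
    calc 2 * (a * (a + c)) ≤ 2 * (a * (a + c)) + c ^ 2 := le_self_add
      _ = _ := by ring
  · obtain ⟨c, rfl⟩ := exists_add_of_le h
    calc 2 * ((b + c) * b) ≤ 2 * ((b + c) * b) + c ^ 2 := le_self_add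
      _ = _ := by ring

/-- there is an open macroscopic path of length `n` -/
def reach (d m n : ℕ) : Set (Config d) :=
  ⋃ w : List (Fin 3 → Bool), ⋃ _ : w.length = n, {ω | ∀ η ∈ FF d m 0 0 w, 0 < ω η}

lemma reach_meas (d m n : ℕ) : MeasurableSet (reach d m n) :=
  MeasurableSet.iUnion fun w => MeasurableSet.iUnion fun _ => meas_pos _

lemma reach_anti (d m : ℕ) : Antitone (reach d m) := by
  intro n n' h ω hω
  simp only [reach, Set.mem_iUnion] at hω ⊢
  obtain ⟨w, hw, h1⟩ := hω
  exact ⟨w.take n, by rw [List.length_take]; omega, fun η hη => h1 η (FF_take w n _ _ hη)⟩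

lemma FF_path {d m : ℕ} (ω : Config d) (w : List (Fin 3 → Bool)) (D : Fin 3 → ℤ) (k : ℤ)
    (h : ∀ η ∈ FF d m D k w, 0 < ω η) :
    ∃ D', Relation.ReflTransGen (EdgeOpen ω) (emb d D k) (emb d D' (k + w.length)) := by
  induction w generalizing D k with
  | nil => exact ⟨D, by simpa using Relation.ReflTransGen.refl⟩
  | cons s w ih =>
    have h1 := tau_path m D k s ω (h _ (by rw [FF]; exact Finset.mem_insert_self _ _))
    obtain ⟨D', h2⟩ := ih (D + sgv s) (k + 1) (fun η hη => h η (by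
      rw [FF]; exact Finset.mem_insert_of_mem hη))
    refine ⟨D', h1.trans ?_⟩
    have e : k + ((s :: w).length : ℤ) = k + 1 + w.length := by
      rw [List.length_cons]; push_cast; ring
    rw [e]; exact h2

lemma reach_perc {d : ℕ} (hd : 4 ≤ d) (m : ℕ) : ⋂ n, reach d m n ⊆ PercEvent d := by
  intro ω hω
  rw [Set.mem_iInter] at hω
  have h1 : ∀ n : ℕ, ∃ y ∈ Cluster ω (0 : Zd d), y ⟨3, by omega⟩ = n := by
    intro n
    have := hω n
    simp only [reach, Set.mem_iUnion] at this
    obtain ⟨w, hw, h⟩ := this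
    obtain ⟨D', hD⟩ := FF_path ω w 0 0 h
    have e0 : emb d 0 0 = 0 := by funext i; simp [emb]
    rw [e0] at hD
    exact ⟨_, hD, by rw [emb_k hd, hw]; simp⟩
  choose y hy hy' using h1
  refine Set.infinite_of_injective_forall_mem (f := y) (fun a b hab => ?_) hy
  have := hy' a
  rw [hab, hy' b] at this
  exact_mod_cast this.symm

lemma reach_prob {d : ℕ} (hd : 4 ≤ d) (m n : ℕ) (P : Measure (Config d)) (p r : ℝ≥0∞)
    (hp0 : p ≠ 0) (hpr : p + r = 1)
    (hr : r * (1 + GG 0) ≤ 8 * p)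
    (hP : ∀ F : Finset (Traj d), (∀ η ∈ F, ∃ D k s, η = tau d m D k s) →
      P {ω | ∀ η ∈ F, 0 < ω η} = p ^ F.card) :
    1 / (1 + GG 0) ≤ P (reach d m n) := by
  have hpt : p ≠ ∞ := by
    rintro rfl
    simp at hpr
  set H := 1 + GG 0 with hH
  have hHt : H ≠ ∞ := by rw [hH]; exact ENNReal.add_ne_top.2 ⟨by simp, GG_zero⟩
  have hH0 : H ≠ 0 := by rw [hH]; simp
  set a := (8 * p) ^ n with ha
  have hat : a ≠ ∞ := ENNReal.pow_ne_top (ENNReal.mul_ne_top (by simp) hpt)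
  have ha0 : a ≠ 0 := pow_ne_zero _ (mul_ne_zero (by simp) hp0)
  let f : List (Fin 3 → Bool) → Config d → ℝ≥0∞ := fun w =>
    Set.indicator {ω | ∀ η ∈ FF d m 0 0 w, 0 < ω η} 1
  have hf : ∀ w, Measurable (f w) := fun w => measurable_one.indicator (meas_pos _)
  let N : Config d → ℝ≥0∞ := fun ω => SW n (fun w => f w ω)
  have hN : Measurable N := SW_meas n (fun ω w => f w ω) hf
  have h1 : ∫⁻ ω, N ω ∂P = a := by
    rw [SW_lint P n (fun ω w => f w ω) hf, SW_congr n _ (fun _ => p ^ n), SW_const, ha, mul_pow]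
    intro w hw
    rw [lintegral_indicator_one (meas_pos _), hP, FF_card hd, hw]
    intro η hη
    obtain ⟨D', k', s, _, h⟩ := FF_mem _ _ _ _ hη
    exact ⟨D', k', s, h⟩
  have h2 : ∫⁻ ω, N ω ^ 2 ∂P ≤ a ^ 2 * H := by
    have e : ∀ ω, N ω ^ 2 = SW n (fun w => SW n (fun w' => f w ω * f w' ω)) := by
      intro ω
      simp only [SW_mul]
      have : (fun w => f w ω * SW n fun w => f w ω) = fun w => (SW n fun w => f w ω) * f w ω := by
        funext w; ring
      rw [this, SW_mul, sq]
    simp only [e]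
    rw [SW_lint P n (fun ω w => SW n (fun w' => f w ω * f w' ω))
      (fun w => SW_meas n (fun ω w' => f w ω * f w' ω) fun w' => (hf w).mul (hf w'))]
    have e2 := second_moment hd m p r hpr hr n 0 0 0
    rw [sub_zero] at e2
    have e3 : a ^ 2 * H = (8 * p) ^ (2 * n) * (1 + GG 0) := by rw [ha, ← pow_mul, mul_comm n 2]
    rw [e3]
    refine le_trans (le_of_eq ?_) e2
    refine SW_congr _ _ _ fun w _ => ?_
    rw [SW_lint P n (fun ω w' => f w ω * f w' ω) (fun w' => (hf w).mul (hf w'))]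
    refine SW_congr _ _ _ fun w' _ => ?_
    rw [← hP]
    · have : (fun ω => f w ω * f w' ω) =
          Set.indicator {ω | ∀ η ∈ FF d m 0 0 w ∪ FF d m 0 0 w', 0 < ω η} 1 := by
        funext ω
        have e : {ω : Config d | ∀ η ∈ FF d m 0 0 w ∪ FF d m 0 0 w', 0 < ω η} =
            {ω | ∀ η ∈ FF d m 0 0 w, 0 < ω η} ∩ {ω | ∀ η ∈ FF d m 0 0 w', 0 < ω η} := by
          ext ω
          simp only [Finset.mem_union, Set.mem_setOf_eq, Set.mem_inter_iff]
          exact ⟨fun h => ⟨fun η hη => h η (Or.inl hη), fun η hη => h η (Or.inr hη)⟩,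
            fun h η hη => hη.elim (h.1 η) (h.2 η)⟩
        rw [e, Set.inter_indicator_one]
        rfl
      rw [this, lintegral_indicator_one (meas_pos _)]
    · intro η hη
      rw [Finset.mem_union] at hη
      rcases hη with hη | hη
      all_goals
        obtain ⟨D', k', s, _, h⟩ := FF_mem _ _ _ _ hη
        exact ⟨D', k', s, h⟩
  have h3 : ∀ ω, 2 * (a * H) * N ω ≤ N ω ^ 2 + (a * H) ^ 2 * (reach d m n).indicator 1 ω := by
    intro ω
    by_cases h0 : N ω = 0
    · rw [h0]; simp
    · obtain ⟨w, hw, hw2⟩ := SW_pos n _ h0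
      have hmem : ω ∈ reach d m n := by
        simp only [reach, Set.mem_iUnion]
        refine ⟨w, hw, ?_⟩
        by_contra hc
        exact hw2 (Set.indicator_of_notMem hc _)
      rw [Set.indicator_of_mem hmem, Pi.one_apply, mul_one]
      calc _ = 2 * (N ω * (a * H)) := by ring
        _ ≤ _ := two_mul_le_sq _ _
  have h4 := lintegral_mono (μ := P) h3
  rw [lintegral_const_mul _ hN, h1, lintegral_add_left (hN.pow_const 2),
    lintegral_const_mul _ (measurable_one.indicator (reach_meas d m n)),
    lintegral_indicator_one (reach_meas d m n)] at h4
  have h5 : a ^ 2 * H + a ^ 2 * H ≤ a ^ 2 * H + a ^ 2 * H * (H * P (reach d m n)) := by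
    calc _ = 2 * (a * H) * a := by ring
      _ ≤ _ := h4
      _ ≤ a ^ 2 * H + (a * H) ^ 2 * P (reach d m n) := add_le_add h2 le_rfl
      _ = _ := by ring
  have hc : a ^ 2 * H ≠ ∞ := ENNReal.mul_ne_top (ENNReal.pow_ne_top hat) hHt
  have hc0 : a ^ 2 * H ≠ 0 := mul_ne_zero (pow_ne_zero _ ha0) hH0
  have h6 := (ENNReal.add_le_add_iff_left hc).1 h5
  have h7 : 1 ≤ H * P (reach d m n) := by
    rw [← ENNReal.mul_le_mul_iff_right hc0 hc, mul_one]
    exact h6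
  rw [ENNReal.div_le_iff hH0 hHt, mul_comm]
  exact h7

lemma perc_large {d : ℕ} (hd : 4 ≤ d) (ρ : ℕ → ℝ) (hmu : 0 ≤ mu 1 ρ) (l : ℕ) (hl : 4 ≤ l)
    (hρ : 0 < ρ l) (X : ℝ → Measure (Config d)) (hX : ∀ u, 0 ≤ u → IsFRI d u ρ (X u)) :
    ∃ u, 0 ≤ u ∧ 0 < X u (PercEvent d) := by
  obtain ⟨m, rfl⟩ : ∃ m, l = m + 4 := ⟨l - 4, by omega⟩
  set h0 : ℝ := (1 + GG 0).toReal with hh0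
  have hHt : 1 + GG 0 ≠ ∞ := ENNReal.add_ne_top.2 ⟨by simp, GG_zero⟩
  have hh : 1 + GG 0 = ENNReal.ofReal h0 := (ENNReal.ofReal_toReal hHt).symm
  have hh0n : 0 ≤ h0 := ENNReal.toReal_nonneg
  have hd0 : (0 : ℝ) < d := by exact_mod_cast (by omega : 0 < d)
  set κ : ℝ := ρ (m + 4) / (mu 1 ρ + 1) * (1 / (2 * (d : ℝ))) ^ (m + 4) with hκ
  have hκ0 : 0 < κ := by positivity
  set u := (1 + h0) / κ with hu
  have hu0 : 0 ≤ u := by positivity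
  refine ⟨u, hu0, ?_⟩
  have hPP := hX u hu0
  have := hPP.1
  have hintens : ∀ D k s, friIntensity d u ρ (tau d m D k s) = 1 + h0 := by
    intro D k s
    unfold friIntensity
    rw [if_pos ⟨by simp [tau], tau_chain hd m D k s⟩, tau_len]
    have : u * κ = 1 + h0 := by rw [hu]; field_simp
    rw [← this, hκ]; ring
  set e := Real.exp (-(1 + h0)) with he
  have he0 : 0 < e := Real.exp_pos _
  have he1 : e * (2 + h0) ≤ 1 := by
    have h1 := Real.add_one_le_exp (1 + h0)
    calc e * (2 + h0) ≤ e * Real.exp (1 + h0) := by gcongr; linarith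
      _ = 1 := by rw [he, ← Real.exp_add]; simp
  have he2 : e ≤ 1 / 2 := by nlinarith
  have hp : (1 : ℝ≥0∞) - ENNReal.ofReal e = ENNReal.ofReal (1 - e) := by
    rw [ENNReal.ofReal_sub _ he0.le, ENNReal.ofReal_one]
  have key : ∀ n, 1 / (1 + GG 0) ≤ X u (reach d m n) := by
    intro n
    refine reach_prob hd m n (X u) (ENNReal.ofReal (1 - e)) (ENNReal.ofReal e) ?_ ?_ ?_ ?_
    · rw [ne_eq, ENNReal.ofReal_eq_zero]; linarith
    · rw [← ENNReal.ofReal_add (by linarith) he0.le]; simp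
    · have h8 : (8 : ℝ≥0∞) = ENNReal.ofReal 8 := by simp
      rw [hh, h8, ← ENNReal.ofReal_mul he0.le, ← ENNReal.ofReal_mul (by norm_num)]
      refine ENNReal.ofReal_le_ofReal ?_
      nlinarith
    · intro F hF
      rw [poisson_pos _ _ hPP, Finset.prod_congr rfl (g := fun _ => ENNReal.ofReal (1 - e))]
      · rw [Finset.prod_const]
      · intro η hη
        obtain ⟨D, k, s, rfl⟩ := hF η hη
        rw [hintens, ← hp]
  have h1 := tendsto_measure_iInter_atTop (μ := X u) (s := reach d m)
    (fun n => (reach_meas d m n).nullMeasurableSet) (reach_anti d m) ⟨0, measure_ne_top _ _⟩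
  have h2 : 1 / (1 + GG 0) ≤ X u (⋂ n, reach d m n) := ge_of_tendsto' h1 key
  have h3 : 0 < 1 / (1 + GG 0) := ENNReal.div_pos (by simp) hHt
  exact h3.trans_le (h2.trans (measure_mono (reach_perc hd m)))


/-! ### Choice of parameters -/

lemma logFour_one {d : ℕ} {x : ℝ} (hx : 1 ≤ x) : 1 ≤ logFour d x := by
  unfold logFour
  split_ifs
  · linarith [Real.log_nonneg hx]
  · simp

lemma logFour_small (d : ℕ) (η : ℝ) (hη : 0 < η) :
    Tendsto (fun x : ℝ => logFour d x / x ^ η) atTop (𝓝 0) := by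
  have h1 : Tendsto (fun x : ℝ => x ^ (-η)) atTop (𝓝 0) := tendsto_rpow_neg_atTop hη
  have h2 : Tendsto (fun x : ℝ => Real.log x / x ^ η) atTop (𝓝 0) :=
    (isLittleO_log_rpow_atTop hη).tendsto_div_nhds_zero
  have h3 := h1.add h2
  rw [add_zero] at h3
  by_cases h : d = 4
  · refine h3.congr' ?_
    filter_upwards [eventually_gt_atTop 0] with x hx
    unfold logFour
    rw [if_pos h, Real.rpow_neg hx.le]
    field_simp
  · refine h1.congr' ?_
    filter_upwards [eventually_gt_atTop 0] with x hx
    unfold logFour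
    rw [if_neg h, Real.rpow_neg hx.le]
    field_simp
    norm_num

set_option maxHeartbeats 3000000 in
lemma param_alg (ε εd η δ lam x k mm cap E y μ2 u : ℝ) (hε0 : 0 < ε) (hε1 : ε < 1) (hεd : 0 < εd)
    (hη : η = ε / 32) (hδ0 : 0 < δ) (hδ : δ ≤ η * εd) (hδ1 : δ ≤ 1) (hlam : 1 ≤ lam) (hx : 1 ≤ x)
    (hk : 1 ≤ k) (hmm : 0 < mm) (hcap0 : 0 ≤ cap) (hE : 0 ≤ E)
    (hxη : 1 / x ≤ η) (hT1 : lam * mm ≤ 2 * y * x) (hy1 : 8 * y ≤ η * εd)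
    (hT3 : lam * cap ≤ εd * (1 + η) / (1 - 3 * η) * k) (hT4 : lam * k ≤ y * mm)
    (hy2 : 4 * E * y ≤ η * εd)
    (hT5 : lam ^ 2 * k ≤ y ^ 2 * x) (hy3 : 18 * y ^ 2 ≤ (1 - ε / 2) * δ * εd)
    (hμ : x ^ 2 ≤ μ2) (hu0 : 0 ≤ u) (hu : u ≤ (1 - ε) * (x * lam / (εd * μ2))) :
    u / (x + 1) * (((k + 1) * (mm * (2 * x) + δ * μ2 / lam) +
        (μ2 + x) * (cap + (k + 1) ^ 2 * (E / mm))) / k) ≤ 1 - ε / 2 ∧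
      u / (x + 1) * (3 * (k + 1) * (μ2 + x + δ * μ2 / lam) * (x + 1)) ≤
        (1 - ε / 2) * (δ * μ2 / lam) := by
  have hx0 : 0 < x := by linarith
  have hlam0 : 0 < lam := by linarith
  have hk0 : 0 < k := by linarith
  have hμ0 : 0 < μ2 := by nlinarith
  have hη0 : 0 < η := by rw [hη]; linarith
  have hη1 : η ≤ 1 / 32 := by rw [hη]; linarith
  have hy0 : 0 ≤ y := by
    by_contra h
    push Not at h
    have := mul_neg_of_neg_of_pos h hmm
    have := mul_pos hlam0 hk0
    linarith
  have hxμ : x ≤ μ2 := by nlinarith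
  constructor
  · have h1 : u / (x + 1) ≤ (1 - ε) * lam / (εd * μ2) := by
      rw [div_le_iff₀ (by linarith)]
      refine hu.trans ?_
      have : (1 - ε) * (x * lam / (εd * μ2)) = (1 - ε) * lam / (εd * μ2) * x := by ring
      rw [this]
      have : 0 ≤ (1 - ε) * lam / (εd * μ2) := by
        have : 0 ≤ 1 - ε := by linarith
        positivity
      nlinarith
    have h2 : (k + 1) * (mm * (2 * x) + δ * μ2 / lam) +
        (μ2 + x) * (cap + (k + 1) ^ 2 * (E / mm)) ≤
        μ2 * ((k + 1) * (2 * mm / x + δ / lam) + (1 + 1 / x) * (cap + (k + 1) ^ 2 * (E / mm))) := by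
      have e1 : x ≤ μ2 / x := by rw [le_div_iff₀ hx0]; nlinarith
      have e2 : mm * (2 * x) ≤ μ2 * (2 * mm / x) := by
        have : μ2 * (2 * mm / x) = mm * (2 * (μ2 / x)) := by ring
        rw [this]; gcongr
      have e3 : (μ2 + x) * (cap + (k + 1) ^ 2 * (E / mm)) ≤
          (μ2 + μ2 / x) * (cap + (k + 1) ^ 2 * (E / mm)) := by gcongr
      have e4 : (k + 1) * (mm * (2 * x)) ≤ (k + 1) * (μ2 * (2 * mm / x)) := by gcongr
      have e5 : μ2 * ((k + 1) * (2 * mm / x + δ / lam) +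
          (1 + 1 / x) * (cap + (k + 1) ^ 2 * (E / mm))) =
          (k + 1) * (μ2 * (2 * mm / x)) + (k + 1) * (δ * μ2 / lam) +
          (μ2 + μ2 / x) * (cap + (k + 1) ^ 2 * (E / mm)) := by ring
      rw [e5]
      linarith
    have h3 : lam * ((k + 1) * (2 * mm / x + δ / lam) +
        (1 + 1 / x) * (cap + (k + 1) ^ 2 * (E / mm))) / k ≤ εd * (1 + 11 * η) := by
      have hk2 : (k + 1) / k ≤ 2 := by rw [div_le_iff₀ hk0]; linarith
      have t1 : 2 * (lam * mm / x) * ((k + 1) / k) ≤ η * εd := by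
        have : lam * mm / x ≤ 2 * y := by rw [div_le_iff₀ hx0]; exact hT1
        calc _ ≤ 2 * (2 * y) * 2 := by gcongr
          _ ≤ _ := by linarith
      have t2 : δ * ((k + 1) / k) ≤ 2 * (η * εd) := by
        calc _ ≤ δ * 2 := by gcongr
          _ ≤ _ := by linarith
      have t3 : lam * cap / k ≤ εd * (1 + 5 * η) := by
        rw [div_le_iff₀ hk0]
        refine hT3.trans ?_
        gcongr
        rw [div_le_iff₀ (by linarith)]
        have : 1 + η ≤ (1 + 5 * η) * (1 - 3 * η) := by nlinarith
        calc εd * (1 + η) ≤ εd * ((1 + 5 * η) * (1 - 3 * η)) := by gcongr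
          _ = _ := by ring
      have t4 : E * (lam * k / mm) * ((k + 1) / k) ^ 2 ≤ η * εd := by
        have : lam * k / mm ≤ y := by rw [div_le_iff₀ hmm]; exact hT4
        calc _ ≤ E * y * 2 ^ 2 := by gcongr
          _ ≤ _ := by linarith
      have e : lam * ((k + 1) * (2 * mm / x + δ / lam) +
        (1 + 1 / x) * (cap + (k + 1) ^ 2 * (E / mm))) / k =
        2 * (lam * mm / x) * ((k + 1) / k) + δ * ((k + 1) / k) +
        (1 + 1 / x) * (lam * cap / k + E * (lam * k / mm) * ((k + 1) / k) ^ 2) := by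
        field_simp
      rw [e]
      calc _ ≤ η * εd + 2 * (η * εd) + (1 + η) * (εd * (1 + 5 * η) + η * εd) := by gcongr
        _ = εd * (1 + 10 * η + 6 * η ^ 2) := by ring
        _ ≤ _ := mul_le_mul_of_nonneg_left (by nlinarith) hεd.le
    calc _ ≤ (1 - ε) * lam / (εd * μ2) * (μ2 * ((k + 1) * (2 * mm / x + δ / lam) +
          (1 + 1 / x) * (cap + (k + 1) ^ 2 * (E / mm))) / k) := by
          gcongr
      _ = (1 - ε) / εd * (lam * ((k + 1) * (2 * mm / x + δ / lam) +
          (1 + 1 / x) * (cap + (k + 1) ^ 2 * (E / mm))) / k) := by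
          field_simp
      _ ≤ (1 - ε) / εd * (εd * (1 + 11 * η)) := by
          have : 0 ≤ 1 - ε := by linarith
          gcongr
      _ = (1 - ε) * (1 + 11 * η) := by field_simp
      _ ≤ _ := by rw [hη]; nlinarith
  · have h1 : δ * μ2 / lam ≤ μ2 := by
      rw [div_le_iff₀ hlam0]; nlinarith
    calc _ = u * (3 * (k + 1) * (μ2 + x + δ * μ2 / lam)) := by field_simp
      _ ≤ (1 - ε) * (x * lam / (εd * μ2)) * (3 * (2 * k) * (μ2 + μ2 + μ2)) := by
          have : 0 ≤ 1 - ε := by linarith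
          gcongr
          linarith
      _ = (1 - ε) * x / (εd * lam) * (18 * (lam ^ 2 * k)) := by field_simp; ring
      _ ≤ 1 * x / (εd * lam) * (18 * (y ^ 2 * x)) := by gcongr; linarith
      _ = (18 * y ^ 2) * (x ^ 2 / (εd * lam)) := by ring
      _ ≤ (1 - ε / 2) * δ * εd * (μ2 / (εd * lam)) := by
          have : 0 ≤ 1 - ε / 2 := by linarith
          gcongr
      _ = _ := by field_simp

set_option maxHeartbeats 1000000 in
lemma params (d : ℕ) (cap : ℕ → ℝ) (hcap : ∀ T, 0 ≤ cap T) (εd : ℝ) (hεd : 0 < εd)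
    (hlim : Tendsto (fun T : ℕ => cap T * logFour d T / (T : ℝ)) atTop (𝓝 εd))
    (ε : ℝ) (hε0 : 0 < ε) (hε1 : ε < 1) (E : ℝ) (hE : 0 ≤ E) :
    ∃ δ : ℝ, 0 < δ ∧ ∀ᶠ x : ℝ in atTop, ∃ K M : ℕ, 0 < K ∧ 0 < M ∧ 1 ≤ x ∧
      ∀ μ2 u : ℝ, x ^ 2 ≤ μ2 → 0 ≤ u → u ≤ (1 - ε) * (x * logFour d x / (εd * μ2)) →
      u / (x + 1) * (((K + 1) * (M * (2 * x) + δ * μ2 / logFour d x) +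
        (μ2 + x) * (cap K + (K + 1) ^ 2 * (E / M))) / K) ≤ 1 - ε / 2 ∧
      u / (x + 1) * (3 * (K + 1) * (μ2 + x + δ * μ2 / logFour d x) * (x + 1)) ≤
        (1 - ε / 2) * (δ * μ2 / logFour d x) := by
  set η := ε / 32 with hη
  have hη0 : 0 < η := by rw [hη]; linarith
  have hη1 : η ≤ 1 / 32 := by rw [hη]; linarith
  set δ := min 1 (η * εd) with hδ
  have hδ0 : 0 < δ := lt_min one_pos (by positivity)
  refine ⟨δ, hδ0, ?_⟩
  have hy := logFour_small d η hη0
  have hK : Tendsto (fun x : ℝ => ⌊x ^ (1 - 2 * η)⌋₊) atTop atTop :=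
    tendsto_nat_floor_atTop.comp (tendsto_rpow_atTop (by linarith))
  have hc := (hlim.comp hK).eventually_le_const (u := εd * (1 + η)) (by nlinarith)
  have hy1 := hy.eventually_le_const (u := η * εd / 8) (by positivity)
  have hy2 := hy.eventually_le_const (u := η * εd / (4 * E + 1)) (by positivity)
  have hy3 := (hy.pow 2).eventually_le_const (u := (1 - ε / 2) * δ * εd / 18) (by
    have : 0 < 1 - ε / 2 := by linarith
    simp
    positivity)
  have hx2 := (tendsto_rpow_atTop hη0).eventually_ge_atTop 2
  filter_upwards [eventually_ge_atTop 1, eventually_ge_atTop (1 / η), hc, hy1, hy2, hy3, hx2]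
    with x hx hxη hc hy1 hy2 hy3 hx2
  have hx0 : 0 < x := by linarith
  have hlam := logFour_one (d := d) hx
  set lam := logFour d x
  set z := x ^ η with hz
  have hz0 : 0 < z := by positivity
  set y := lam / z with hyd
  have hy0 : 0 ≤ y := by positivity
  set a := x ^ (1 - 2 * η) with ha
  set b := x ^ (1 - η) with hb
  have ha0 : 0 < a := by positivity
  have ha1 : 1 ≤ a := Real.one_le_rpow hx (by linarith)
  have hb1 : 1 ≤ b := Real.one_le_rpow hx (by linarith)
  have hab : a * z = b := by
    rw [ha, hz, hb, ← Real.rpow_add hx0]; congr 1; ring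
  have hbx : b * z = x := by
    rw [hz, hb, ← Real.rpow_add hx0]; norm_num
  have hlz : lam = y * z := by rw [hyd]; field_simp
  set K := ⌊a⌋₊
  set M := ⌈b⌉₊
  have hK1 : 0 < K := Nat.floor_pos.2 ha1
  have hKle : (K : ℝ) ≤ a := Nat.floor_le ha0.le
  have hKlt : a < K + 1 := Nat.lt_floor_add_one a
  have hMge : b ≤ M := Nat.le_ceil b
  have hMlt : (M : ℝ) < b + 1 := Nat.ceil_lt_add_one (by linarith)
  have hM1 : (0 : ℝ) < M := by linarith
  have hKr : (1 : ℝ) ≤ K := by exact_mod_cast hK1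
  refine ⟨K, M, hK1, by exact_mod_cast hM1, hx, fun μ2 u hμ hu0 hu => ?_⟩
  refine param_alg ε εd η δ lam x K M (cap K) E y μ2 u hε0 hε1 hεd hη hδ0 (min_le_right _ _)
    (min_le_left _ _) hlam hx hKr hM1 (hcap K) hE ?_ ?_ ?_ ?_ ?_ ?_ ?_ ?_ hμ hu0 hu
  · rw [div_le_iff₀ hx0]
    rw [div_le_iff₀ hη0] at hxη
    linarith
  · calc lam * M ≤ lam * (2 * b) := by gcongr; linarith
      _ = 2 * y * x := by rw [hlz, ← hbx]; ring
  · linarith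
  · have h1 : (1 - 3 * η) * lam ≤ logFour d K := by
      have hKa : x ^ (1 - 3 * η) ≤ K := by
        have e : x ^ (1 - 3 * η) * z = a := by
          rw [ha, hz, ← Real.rpow_add hx0]; congr 1; ring
        have : 0 < x ^ (1 - 3 * η) := by positivity
        nlinarith
      have h2 : (1 - 3 * η) * Real.log x ≤ Real.log K := by
        rw [← Real.log_rpow hx0]
        exact Real.log_le_log (by positivity) hKa
      change (1 - 3 * η) * logFour d x ≤ logFour d K
      unfold logFour
      split_ifs
      · linarith
      · linarith
    have h2 : cap K * logFour d K ≤ εd * (1 + η) * K := by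
      have : cap K * logFour d K / K ≤ εd * (1 + η) := hc
      rwa [div_le_iff₀ (by linarith)] at this
    rw [div_mul_eq_mul_div, le_div_iff₀ (by linarith)]
    calc lam * cap K * (1 - 3 * η) = cap K * ((1 - 3 * η) * lam) := by ring
      _ ≤ cap K * logFour d K := mul_le_mul_of_nonneg_left h1 (hcap K)
      _ ≤ _ := h2
  · calc lam * K ≤ lam * a := by gcongr
      _ = y * b := by rw [hlz, ← hab]; ring
      _ ≤ y * M := by gcongr
  · rw [le_div_iff₀ (by positivity)] at hy2
    nlinarith
  · calc lam ^ 2 * K ≤ lam ^ 2 * a := by gcongr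
      _ = y ^ 2 * x := by rw [hlz, ← hbx, ← hab]; ring
  · linarith


lemma tsum_anti_weight (f r : ℕ → ℝ≥0∞) :
    ∑' j : ℕ, ∑' l : ℕ, f l * r (j + l) =
      ∑' n : ℕ, (∑ k ∈ Finset.range (n + 1), f k) * r n := by
  rw [← ENNReal.tsum_prod (f := fun j l => f l * r (j + l)),
    ← Equiv.tsum_eq (Finset.HasAntidiagonal.sigmaAntidiagonalEquivProd (A := ℕ))
      (fun p : ℕ × ℕ => f p.2 * r (p.1 + p.2)),
    ENNReal.tsum_sigma']
  refine tsum_congr fun n => ?_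
  rw [tsum_fintype]
  have : ∀ c : Finset.HasAntidiagonal.antidiagonal n,
      f (Finset.HasAntidiagonal.sigmaAntidiagonalEquivProd (A := ℕ) ⟨n, c⟩).2 *
      r ((Finset.HasAntidiagonal.sigmaAntidiagonalEquivProd (A := ℕ) ⟨n, c⟩).1 +
      (Finset.HasAntidiagonal.sigmaAntidiagonalEquivProd (A := ℕ) ⟨n, c⟩).2) = f c.1.2 * r n := by
    rintro ⟨c, hc⟩
    simp only [Finset.HasAntidiagonal.sigmaAntidiagonalEquivProd_apply]
    rw [Finset.HasAntidiagonal.mem_antidiagonal.1 hc]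
  simp only [this]
  rw [← Finset.sum_mul, Finset.univ_eq_attach,
    Finset.sum_attach (Finset.HasAntidiagonal.antidiagonal n) (fun p : ℕ × ℕ => f p.2),
    Finset.Nat.sum_antidiagonal_eq_sum_range_succ_mk]
  congr 1
  exact Finset.sum_range_reflect f (n + 1)

lemma awt_sum (r : ℕ → ℝ≥0∞) :
    ∑' m, awt r m = ∑' n : ℕ, (n : ℝ≥0∞) * (n + 1) * r n := by
  unfold awt
  rw [ENNReal.tsum_mul_left, tsum_anti_weight (fun k => (k : ℝ≥0∞)) r, ← ENNReal.tsum_mul_left]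
  refine tsum_congr fun n => ?_
  rw [← mul_assoc]
  congr 1
  have := Finset.sum_range_id_mul_two (n + 1)
  have h2 : ((∑ i ∈ Finset.range (n + 1), i : ℕ) : ℝ≥0∞) * 2 = ((n + 1) * n : ℕ) := by
    rw [← Nat.add_sub_cancel n 1] at *
    exact_mod_cast this
  push_cast at h2
  rw [mul_comm, h2, mul_comm]

lemma awt_le (r : ℕ → ℝ≥0∞) (m : ℕ) : awt r m ≤ 2 * ∑' n : ℕ, (n : ℝ≥0∞) * r n := by
  unfold awt
  refine mul_le_mul_right ?_ _
  calc ∑' k : ℕ, (k : ℝ≥0∞) * r (m + k) ≤ ∑' k : ℕ, ((m + k : ℕ) : ℝ≥0∞) * r (m + k) := by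
        refine ENNReal.tsum_le_tsum fun k => mul_le_mul_left ?_ _
        exact_mod_cast (by omega : k ≤ m + k)
    _ ≤ _ := ENNReal.tsum_comp_le_tsum_of_injective (add_right_injective m)
        (fun n => (n : ℝ≥0∞) * r n)

section moments
variable {ρ : ℕ → ℝ}

lemma summ1 (h : IsDist ρ) (h2 : Summable fun l : ℕ => (l : ℝ) ^ 2 * ρ l) :
    Summable fun l : ℕ => (l : ℝ) ^ 1 * ρ l := by
  refine Summable.of_nonneg_of_le (fun l => mul_nonneg (by positivity) (h.1 l)) (fun l => ?_) h2
  refine mul_le_mul_of_nonneg_right ?_ (h.1 l)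
  have : l ^ 1 ≤ l ^ 2 := by nlinarith [Nat.zero_le l, Nat.le_mul_self l]
  exact_mod_cast this

lemma mu_sq (h : IsDist ρ) (h2 : Summable fun l : ℕ => (l : ℝ) ^ 2 * ρ l) :
    mu 1 ρ ^ 2 ≤ mu 2 ρ := by
  have s1 := (summ1 h h2).hasSum
  have s2 := h2.hasSum
  have hs := (s2.sub (s1.mul_left (2 * mu 1 ρ))).add (h.2.mul_left (mu 1 ρ ^ 2))
  have := hs.nonneg (fun l => by
    have : (l : ℝ) ^ 2 * ρ l - 2 * mu 1 ρ * ((l : ℝ) ^ 1 * ρ l) + mu 1 ρ ^ 2 * ρ l =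
      ((l : ℝ) - mu 1 ρ) ^ 2 * ρ l := by ring
    rw [this]
    exact mul_nonneg (sq_nonneg _) (h.1 l))
  change 0 ≤ mu 2 ρ - 2 * mu 1 ρ * mu 1 ρ + mu 1 ρ ^ 2 * 1 at this
  nlinarith

lemma mu_nonneg (h : IsDist ρ) (k : ℕ) : 0 ≤ mu k ρ :=
  tsum_nonneg fun l => mul_nonneg (by positivity) (h.1 l)

lemma r_sum1 (h : IsDist ρ) (h2 : Summable fun l : ℕ => (l : ℝ) ^ 2 * ρ l) :
    ∑' n : ℕ, (n : ℝ≥0∞) * ENNReal.ofReal (ρ n) = ENNReal.ofReal (mu 1 ρ) := by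
  unfold mu
  rw [ENNReal.ofReal_tsum_of_nonneg (fun l => mul_nonneg (by positivity) (h.1 l)) (summ1 h h2)]
  refine tsum_congr fun n => ?_
  rw [ENNReal.ofReal_mul (by positivity), pow_one, ENNReal.ofReal_natCast]

lemma r_sum0 (h : IsDist ρ) (h2 : Summable fun l : ℕ => (l : ℝ) ^ 2 * ρ l) :
    ∑' n : ℕ, ((n : ℝ≥0∞) + 1) * ENNReal.ofReal (ρ n) = ENNReal.ofReal (mu 1 ρ + 1) := by
  simp only [add_mul, one_mul]
  rw [ENNReal.tsum_add, r_sum1 h h2, ENNReal.ofReal_add (mu_nonneg h 1) (by norm_num),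
    ← ENNReal.ofReal_tsum_of_nonneg h.1 h.2.summable, h.2.tsum_eq]

lemma r_sum2 (h : IsDist ρ) (h2 : Summable fun l : ℕ => (l : ℝ) ^ 2 * ρ l) :
    ∑' n : ℕ, (n : ℝ≥0∞) * (n + 1) * ENNReal.ofReal (ρ n) =
      ENNReal.ofReal (mu 2 ρ + mu 1 ρ) := by
  have : ∀ n : ℕ, (n : ℝ≥0∞) * (n + 1) * ENNReal.ofReal (ρ n) =
      (n : ℝ≥0∞) ^ 2 * ENNReal.ofReal (ρ n) + n * ENNReal.ofReal (ρ n) := fun n => by ring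
  simp only [this]
  rw [ENNReal.tsum_add, r_sum1 h h2, ENNReal.ofReal_add (mu_nonneg h 2) (mu_nonneg h 1)]
  congr 1
  unfold mu
  rw [ENNReal.ofReal_tsum_of_nonneg (fun l => mul_nonneg (by positivity) (h.1 l)) h2]
  refine tsum_congr fun n => ?_
  rw [ENNReal.ofReal_mul (by positivity), ENNReal.ofReal_pow (by positivity),
    ENNReal.ofReal_natCast]

lemma ex_large (h : IsDist ρ) (h2 : Summable fun l : ℕ => (l : ℝ) ^ 2 * ρ l) (hmu : 3 < mu 1 ρ) :
    ∃ l, 4 ≤ l ∧ 0 < ρ l := by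
  by_contra hc
  push Not at hc
  have : mu 1 ρ ≤ 3 * 1 := by
    refine hasSum_le (fun l => ?_) (summ1 h h2).hasSum (h.2.mul_left 3)
    by_cases hl : 4 ≤ l
    · have : ρ l = 0 := le_antisymm (hc l hl) (h.1 l)
      rw [this]; simp
    · refine mul_le_mul_of_nonneg_right ?_ (h.1 l)
      rw [pow_one]
      exact_mod_cast (by omega : l ≤ 3)
  linarith

end moments

lemma sub_u {d : ℕ} (hd : 4 ≤ d) (Pw : Zd d → Measure (ℕ → Zd d)) (hPw : IsSRWFamily d Pw)
    (ρ : ℕ → ℝ) (h : IsDist ρ) (h2 : Summable fun l : ℕ => (l : ℝ) ^ 2 * ρ l)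
    (u : ℝ) (hu : 0 ≤ u) (θ q : ℝ) (hθ : 0 < θ) (hq0 : 0 ≤ q) (hq : q < 1)
    (K M : ℕ) (hK : 0 < K) (hM : 0 < M) (hcap : 0 ≤ capExpect Pw K)
    (i1 : u / (mu 1 ρ + 1) * (((K + 1) * (M * (2 * mu 1 ρ) + θ) +
        (mu 2 ρ + mu 1 ρ) * (capExpect Pw K + (K + 1) ^ 2 * (64 * d ^ 2 / M))) / K) ≤ q)
    (i2 : u / (mu 1 ρ + 1) * (3 * (K + 1) * (mu 2 ρ + mu 1 ρ + θ) * (mu 1 ρ + 1)) ≤ q * θ)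
    (P : Measure (Config d)) (hP : IsFRI d u ρ P) : P (PercEvent d) = 0 := by
  have hd0 : 0 < d := by omega
  have hm1 := mu_nonneg h 1
  have hm2 := mu_nonneg h 2
  have hKr : (0 : ℝ) < K := by exact_mod_cast hK
  have hMr : (0 : ℝ) < M := by exact_mod_cast hM
  set r : ℕ → ℝ≥0∞ := fun L => ENNReal.ofReal (ρ L) with hr
  have hS : ∑' m, awt r m = ENNReal.ofReal (mu 2 ρ + mu 1 ρ) := by rw [awt_sum, r_sum2 h h2]
  have ha : ∀ m, awt r m ≤ ENNReal.ofReal (2 * mu 1 ρ) := by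
    intro m
    refine (awt_le r m).trans (le_of_eq ?_)
    rw [r_sum1 h h2, ENNReal.ofReal_mul (by norm_num)]; simp
  have hKe : (K : ℝ≥0∞) = ENNReal.ofReal K := by simp
  have hMe : (M : ℝ≥0∞) = ENNReal.ofReal M := by simp
  have h1e : (1 : ℝ≥0∞) = ENNReal.ofReal 1 := by simp
  have h3e : (3 : ℝ≥0∞) = ENNReal.ofReal 3 := by simp
  have hK1e : (K : ℝ≥0∞) + 1 = ENNReal.ofReal (K + 1) := by
    rw [ENNReal.ofReal_add hKr.le (by norm_num)]; simp
  have hms := main_step hd0 u hu ρ hm1 r hr (ENNReal.ofReal θ) (ENNReal.ofReal q) K hK ?_ ?_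
  · refine no_perc (friIntensity d u ρ) P hP ?_
    refine chain_total _ (pot (awt r) (ENNReal.ofReal θ)) (ENNReal.ofReal q) (ENNReal.ofReal θ)
      ?_ ?_ ENNReal.ofReal_ne_top ?_ ?_ hms
    · rw [← ENNReal.ofReal_one]
      exact (ENNReal.ofReal_lt_ofReal_iff one_pos).2 hq
    · rw [ne_eq, ENNReal.ofReal_eq_zero]; linarith
    · rintro A ⟨x, hx⟩
      unfold pot
      refine le_trans ?_ (Finset.single_le_sum (f := fun x => ∑' m, awt r m * esc A x m +
        ENNReal.ofReal θ) (fun _ _ => zero_le) hx)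
      exact le_add_self
    · refine ne_top_of_le_ne_top ?_ (pot_le_card hd0 _ _ _)
      rw [hS]
      exact ENNReal.mul_ne_top (by simp) (by simp)
  · have hb := b_bound hd Pw hPw (awt r) _ ha (ENNReal.ofReal θ) M hM K
    refine (mul_le_mul_right (ENNReal.div_le_div_right hb _) _).trans ?_
    rw [hS, hK1e, hMe, hKe, ← ENNReal.ofReal_mul (by positivity),
      ← ENNReal.ofReal_add (by positivity) hθ.le, ← ENNReal.ofReal_mul (by positivity),
      ← ENNReal.ofReal_pow (by positivity), ← ENNReal.ofReal_mul (by positivity),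
      ← ENNReal.ofReal_add hcap (by positivity), ← ENNReal.ofReal_mul (by positivity),
      ← ENNReal.ofReal_add (by positivity) (by positivity),
      ← ENNReal.ofReal_div_of_pos hKr, ← ENNReal.ofReal_mul (by positivity)]
    exact ENNReal.ofReal_le_ofReal i1
  · rw [hS, r_sum0 h h2, hK1e, h3e, ← ENNReal.ofReal_add (by positivity) hθ.le,
      ← ENNReal.ofReal_mul (by positivity), ← ENNReal.ofReal_mul (by positivity),
      ← ENNReal.ofReal_mul (by positivity), ← ENNReal.ofReal_mul (by positivity),
      ← ENNReal.ofReal_mul hq0]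
    exact ENNReal.ofReal_le_ofReal i2

/-- **Lower bound.** For `d ≥ 4`, an appropriate family `(ρ_n)` and `ε ∈ (0,1)`,
for all large `n` the cluster of the origin in `ℐ^{(1-ε)u_n, ρ_n}` is a.s. finite;
in particular `u_*(ρ_n) ≥ (1-ε)·u_n`. -/
theorem fri_subcritical_below
    (d : ℕ) (hd : 4 ≤ d)
    (ρ : ℕ → ℕ → ℝ) (hρ : Appropriate ρ)
    (Pw : Zd d → Measure (ℕ → Zd d)) (hPw : IsSRWFamily d Pw)
    (εd : ℝ) (hεd : IsCapLimit d Pw εd)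
    (ε : ℝ) (hε0 : 0 < ε) (hε1 : ε < 1)
    (X : ℕ → ℝ → Measure (Config d))
    (hX : ∀ n : ℕ, ∀ u : ℝ, 0 ≤ u → IsFRI d u (ρ n) (X n u)) :
    ∀ᶠ n in atTop,
      X n ((1 - ε) * uN d εd (ρ n)) (PercEvent d) = 0 ∧
        (1 - ε) * uN d εd (ρ n) ≤ uStar d (X n) := by
  obtain ⟨hdist, hs2, hmu, -⟩ := hρ
  have hcap : ∀ T, 0 ≤ capExpect Pw T := by
    intro T
    refine integral_nonneg fun ω => Finset.sum_nonneg fun x _ => ?_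
    unfold equil
    split_ifs <;> simp
  obtain ⟨δ, hδ, hp⟩ := params d (capExpect Pw) hcap εd hεd.1 hεd.2 ε hε0 hε1 (64 * d ^ 2)
    (by positivity)
  filter_upwards [hmu.eventually hp, hmu.eventually_gt_atTop 3] with n ⟨K, M, hK, hM, hx, hpar⟩ hmu3
  have hsq := mu_sq (hdist n) (hs2 n)
  have hlam := logFour_one (d := d) hx
  have hμ2 : 0 < mu 2 (ρ n) := by nlinarith
  have hεd0 := hεd.1
  have hu0 : 0 ≤ (1 - ε) * uN d εd (ρ n) := by
    have : 0 ≤ 1 - ε := by linarith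
    unfold uN
    positivity
  have key : ∀ u, 0 ≤ u → u ≤ (1 - ε) * uN d εd (ρ n) → X n u (PercEvent d) = 0 := by
    intro u hu hu2
    obtain ⟨i1, i2⟩ := hpar (mu 2 (ρ n)) u hsq hu hu2
    exact sub_u hd Pw hPw (ρ n) (hdist n) (hs2 n) u hu (δ * mu 2 (ρ n) / logFour d (mu 1 (ρ n)))
      (1 - ε / 2) (by positivity) (by linarith) (by linarith) K M hK hM (hcap K) i1 i2 _
      (hX n u hu)
  refine ⟨key _ hu0 le_rfl, ?_⟩
  obtain ⟨l, hl, hρl⟩ := ex_large (hdist n) (hs2 n) hmu3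
  obtain ⟨u1, hu1, hu1'⟩ := perc_large hd (ρ n) (mu_nonneg (hdist n) 1) l hl hρl (X n) (hX n)
  refine le_csInf ⟨u1, hu1, hu1'⟩ ?_
  rintro u ⟨hu, hu'⟩
  by_contra hc
  push Not at hc
  rw [key u hu hc.le] at hu'
  exact lt_irrefl _ hu'

end FRIPaper
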